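/- arXiv:1803.03118 — 3 statements merged into one kernel-verified Lean document; each statement's English description precedes it below -/
import Mathlib

section
/- Let n ≥ 2 be an integer, λ = (n-1)/2, m ∈ ℕ, and ψ_m(t) = (2^m/√Γ(2m)) t^m e^{-t}. Then the normalized Poisson wavelets G_a^m(t) = Σ_{l=0}^∞ ((λ+l)/λ) ψ_m(al) C_l^λ(t) satisfy both wavelet admissibility conditions: (1) ∫₀^∞ |ψ_m(t)|² dt/t = 1; and (2) there exists a constant c, independent of R, such that for every R > 0, ∫_{-1}^1 |Σ_{l=1}^∞ ((λ+l)/λ) (∫_R^∞ |ψ_m(al)|² da/a) C_l^λ(t)| (1-t²)^{λ-1/2} dt ≤ c. -/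
open Real MeasureTheory Set Filter
open scoped RealInnerProductSpace BigOperators

noncomputable def lamb (n : ℕ) : ℝ := ((n : ℝ) - 1) / 2

noncomputable def gegenbauer (lam : ℝ) (l : ℕ) (t : ℝ) : ℝ :=
  ∑ k ∈ Finset.range (l / 2 + 1),
    (-1 : ℝ) ^ k * Real.Gamma ((l : ℝ) - (k : ℝ) + lam) /
      (Real.Gamma lam * (Nat.factorial k : ℝ) * (Nat.factorial (l - 2 * k) : ℝ)) *
      (2 * t) ^ (l - 2 * k)

noncomputable def sigmaN (n : ℕ) : ℝ := 2 * Real.pi ^ (lamb n + 1) / Real.Gamma (lamb n + 1)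

noncomputable def pw (n : ℕ) (a : ℝ) (m : ℕ) (t : ℝ) : ℝ :=
  (1 / sigmaN n) * ∑' l : ℕ, ((lamb n + l) / lamb n) * (a * l) ^ m * Real.exp (-(a * l)) *
    gegenbauer (lamb n) l t

/-- Terms of the Gegenbauer polynomial, extended by zero. -/
noncomputable def gterm (μ t : ℝ) (l k : ℕ) : ℝ :=
  if 2 * k ≤ l then
    (-1 : ℝ) ^ k * Real.Gamma ((k : ℝ) + ((l - 2 * k : ℕ) : ℝ) + μ) /
      (Real.Gamma μ * (Nat.factorial k : ℝ) * (Nat.factorial (l - 2 * k) : ℝ)) *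
      (2 * t) ^ (l - 2 * k)
  else 0

lemma gterm_of_lt (μ t : ℝ) (l k : ℕ) (h : l < 2 * k) : gterm μ t l k = 0 := by
  unfold gterm; rw [if_neg (by omega)]

lemma gterm_add (μ t : ℝ) (i k : ℕ) : gterm μ t (2 * k + i) k =
    (-1 : ℝ) ^ k * Real.Gamma ((k : ℝ) + (i : ℝ) + μ) /
      (Real.Gamma μ * (Nat.factorial k : ℝ) * (Nat.factorial i : ℝ)) * (2 * t) ^ i := by
  unfold gterm; rw [if_pos (by omega), Nat.add_sub_cancel_left]

lemma gegenbauer_eq (μ t : ℝ) (l N : ℕ) (hN : l / 2 + 1 ≤ N) :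
    gegenbauer μ l t = ∑ k ∈ Finset.range N, gterm μ t l k := by
  unfold gegenbauer
  rw [← Finset.sum_subset (Finset.range_mono hN)]
  · apply Finset.sum_congr rfl
    intro k hk
    have hk' : 2 * k ≤ l := by have := Finset.mem_range.1 hk; omega
    unfold gterm
    rw [if_pos hk', Nat.cast_sub hk']
    congr 4
    push_cast; ring
  · intro k _ hk
    apply gterm_of_lt
    simp at hk; omega

lemma gterm_rec0 (μ t : ℝ) (hμ : 0 < μ) (l : ℕ) :
    ((l : ℝ) + 1) * gterm μ t (l + 1) 0 = 2 * (l + μ) * t * gterm μ t l 0 := by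
  have h1 := gterm_add μ t (l + 1) 0
  have h2 := gterm_add μ t l 0
  simp only [mul_zero, zero_add, pow_zero, one_mul, Nat.cast_zero, Nat.factorial_zero,
    Nat.cast_one, mul_one] at h1 h2
  rw [h1, h2]
  have hG : Real.Gamma (((l + 1 : ℕ) : ℝ) + μ) = (l + μ) * Real.Gamma (l + μ) := by
    rw [← Real.Gamma_add_one (by positivity)]; congr 1; push_cast; ring
  rw [hG, Nat.factorial_succ]
  have := (Real.Gamma_pos_of_pos hμ).ne'
  have : (l.factorial : ℝ) ≠ 0 := by positivity
  push_cast
  rw [pow_succ]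
  field_simp

lemma gterm_rec1 (μ t : ℝ) (hμ : 0 < μ) (l k : ℕ) :
    ((l : ℝ) + 2) * gterm μ t (l + 2) (k + 1) = 2 * (l + 1 + μ) * t * gterm μ t (l + 1) (k + 1)
      - (l + 2 * μ) * gterm μ t l k := by
  have hΓ := (Real.Gamma_pos_of_pos hμ).ne'
  have hkf : (k.factorial : ℝ) ≠ 0 := by positivity
  rcases lt_trichotomy l (2 * k) with h | h | h
  · rw [gterm_of_lt _ _ _ _ (by omega), gterm_of_lt _ _ _ _ (by omega),
      gterm_of_lt _ _ _ _ (by omega)]; ring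
  · subst h
    rw [gterm_of_lt _ _ (2 * k + 1) _ (by omega)]
    have h1 := gterm_add μ t 0 (k + 1)
    have h2 := gterm_add μ t 0 k
    rw [show 2 * k + 2 = 2 * (k + 1) + 0 by ring, h1, show gterm μ t (2 * k) k = _ from h2]
    have hG : Real.Gamma (((k + 1 : ℕ) : ℝ) + ((0 : ℕ) : ℝ) + μ) = (k + μ) * Real.Gamma (k + ((0 : ℕ) : ℝ) + μ) := by
      simp only [Nat.cast_zero, add_zero]
      rw [← Real.Gamma_add_one (by positivity)]; congr 1; push_cast; ring
    rw [hG, Nat.factorial_succ]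
    push_cast
    field_simp
    ring
  · obtain ⟨i, rfl⟩ : ∃ i, l = 2 * k + (i + 1) := ⟨l - 2 * k - 1, by omega⟩
    have h1 := gterm_add μ t (i + 1) (k + 1)
    have h2 := gterm_add μ t i (k + 1)
    have h3 := gterm_add μ t (i + 1) k
    rw [show 2 * k + (i + 1) + 2 = 2 * (k + 1) + (i + 1) by ring, h1,
      show 2 * k + (i + 1) + 1 = 2 * (k + 1) + i by ring, h2, h3]
    have hG : Real.Gamma (((k + 1 : ℕ) : ℝ) + ((i + 1 : ℕ) : ℝ) + μ)
        = (k + i + 1 + μ) * Real.Gamma (k + i + 1 + μ) := by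
      rw [← Real.Gamma_add_one (by positivity)]; congr 1; push_cast; ring
    have hG2 : Real.Gamma (((k + 1 : ℕ) : ℝ) + (i : ℝ) + μ) = Real.Gamma (k + i + 1 + μ) := by
      congr 1; push_cast; ring
    have hG3 : Real.Gamma ((k : ℝ) + ((i + 1 : ℕ) : ℝ) + μ) = Real.Gamma (k + i + 1 + μ) := by
      congr 1; push_cast; ring
    rw [hG, hG2, hG3, Nat.factorial_succ, Nat.factorial_succ]
    have : (i.factorial : ℝ) ≠ 0 := by positivity
    push_cast
    field_simp
    ring

lemma gegenbauer_rec (μ t : ℝ) (hμ : 0 < μ) (l : ℕ) :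
    ((l : ℝ) + 2) * gegenbauer μ (l + 2) t = 2 * (l + 1 + μ) * t * gegenbauer μ (l + 1) t
      - (l + 2 * μ) * gegenbauer μ l t := by
  rw [gegenbauer_eq μ t (l + 2) (l + 2 + 1) (by omega),
    gegenbauer_eq μ t (l + 1) (l + 2 + 1) (by omega), gegenbauer_eq μ t l (l + 2) (by omega),
    Finset.sum_range_succ', Finset.sum_range_succ' (fun k => gterm μ t (l + 1) k)]
  have h0 := gterm_rec0 μ t hμ (l + 1)
  have h1 := Finset.sum_congr (rfl : Finset.range (l + 2) = Finset.range (l + 2))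
    (fun k _ => gterm_rec1 μ t hμ l k)
  rw [Finset.sum_sub_distrib, ← Finset.mul_sum, ← Finset.mul_sum, ← Finset.mul_sum] at h1
  push_cast at h0
  linear_combination h0 + h1

lemma gegenbauer_zero (μ t : ℝ) (hμ : 0 < μ) : gegenbauer μ 0 t = 1 := by
  have := (Real.Gamma_pos_of_pos hμ).ne'
  simp [gegenbauer, this]

lemma gegenbauer_one (μ t : ℝ) (hμ : 0 < μ) : gegenbauer μ 1 t = 2 * μ * t := by
  have := (Real.Gamma_pos_of_pos hμ).ne'
  simp [gegenbauer]
  rw [add_comm, Real.Gamma_add_one hμ.ne']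
  field_simp

lemma gterm_up0 (μ t : ℝ) (hμ : 0 < μ) (l : ℕ) :
    (μ + l) / μ * gterm μ t l 0 = gterm (μ + 1) t l 0 := by
  have h1 := gterm_add μ t l 0
  have h2 := gterm_add (μ + 1) t l 0
  simp only [mul_zero, zero_add, pow_zero, one_mul, Nat.cast_zero, Nat.factorial_zero,
    Nat.cast_one, mul_one] at h1 h2
  rw [h1, h2]
  have hG : Real.Gamma ((l : ℝ) + (μ + 1)) = (l + μ) * Real.Gamma (l + μ) := by
    rw [← Real.Gamma_add_one (by positivity)]; congr 1; ring
  rw [hG, Real.Gamma_add_one hμ.ne']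
  have := (Real.Gamma_pos_of_pos hμ).ne'
  have : (l.factorial : ℝ) ≠ 0 := by positivity
  field_simp
  ring

lemma gterm_up1 (μ t : ℝ) (hμ : 0 < μ) (l k : ℕ) :
    (μ + ((l : ℝ) + 2)) / μ * gterm μ t (l + 2) (k + 1) =
      gterm (μ + 1) t (l + 2) (k + 1) - gterm (μ + 1) t l k := by
  have hΓ := (Real.Gamma_pos_of_pos hμ).ne'
  have hkf : (k.factorial : ℝ) ≠ 0 := by positivity
  rcases lt_or_ge l (2 * k) with h | h
  · rw [gterm_of_lt _ _ _ _ (by omega), gterm_of_lt _ _ _ _ (by omega),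
      gterm_of_lt _ _ _ _ (by omega)]; ring
  · obtain ⟨i, rfl⟩ : ∃ i, l = 2 * k + i := ⟨l - 2 * k, by omega⟩
    have h1 := gterm_add μ t i (k + 1)
    have h2 := gterm_add (μ + 1) t i (k + 1)
    have h3 := gterm_add (μ + 1) t i k
    rw [show 2 * k + i + 2 = 2 * (k + 1) + i by ring, h1, h2, h3]
    have hG : Real.Gamma (((k + 1 : ℕ) : ℝ) + (i : ℝ) + (μ + 1))
        = (k + i + 1 + μ) * Real.Gamma (k + i + 1 + μ) := by
      rw [← Real.Gamma_add_one (by positivity)]; congr 1; push_cast; ring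
    have hG2 : Real.Gamma (((k + 1 : ℕ) : ℝ) + (i : ℝ) + μ) = Real.Gamma (k + i + 1 + μ) := by
      congr 1; push_cast; ring
    have hG3 : Real.Gamma ((k : ℝ) + (i : ℝ) + (μ + 1)) = Real.Gamma (k + i + 1 + μ) := by
      congr 1; ring
    rw [hG, hG2, hG3, Nat.factorial_succ, Real.Gamma_add_one hμ.ne']
    have : (i.factorial : ℝ) ≠ 0 := by positivity
    push_cast
    field_simp
    ring

lemma gegenbauer_up (μ t : ℝ) (hμ : 0 < μ) (l : ℕ) :
    (μ + ((l : ℝ) + 2)) / μ * gegenbauer μ (l + 2) t =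
      gegenbauer (μ + 1) (l + 2) t - gegenbauer (μ + 1) l t := by
  rw [gegenbauer_eq μ t (l + 2) (l + 2 + 1) (by omega),
    gegenbauer_eq (μ + 1) t (l + 2) (l + 2 + 1) (by omega),
    gegenbauer_eq (μ + 1) t l (l + 2) (by omega),
    Finset.sum_range_succ', Finset.sum_range_succ' (fun k => gterm (μ + 1) t (l + 2) k)]
  have h0 := gterm_up0 μ t hμ (l + 2)
  have h1 := Finset.sum_congr (rfl : Finset.range (l + 2) = Finset.range (l + 2))
    (fun k _ => gterm_up1 μ t hμ l k)
  rw [Finset.sum_sub_distrib, ← Finset.mul_sum] at h1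
  push_cast at h0
  linear_combination h0 + h1

/-- Coefficients of `(1-z)^(-μ)`. -/
noncomputable def uu (μ : ℝ) (j : ℕ) : ℂ := Ring.choose ((μ : ℂ) + j - 1) j

lemma uu_eq (μ : ℝ) (j : ℕ) : (j.factorial : ℂ) * uu μ j = (ascPochhammer ℂ j).eval (μ : ℂ) := by
  have := Ring.factorial_nsmul_multichoose_eq_ascPochhammer (μ : ℂ) j
  rw [nsmul_eq_mul, Polynomial.ascPochhammer_smeval_eq_eval] at this
  rw [← this, uu, Ring.choose]
  congr 2
  ring

lemma uu_zero (μ : ℝ) : uu μ 0 = 1 := by simp [uu]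

lemma uu_succ (μ : ℝ) (j : ℕ) : ((j : ℂ) + 1) * uu μ (j + 1) = (μ + j) * uu μ j := by
  have h1 := uu_eq μ (j + 1)
  have h0 := uu_eq μ j
  rw [ascPochhammer_succ_eval, ← h0, Nat.factorial_succ] at h1
  have : (j.factorial : ℂ) ≠ 0 := by exact_mod_cast j.factorial_ne_zero
  apply mul_left_cancel₀ this
  push_cast at h1
  linear_combination h1

lemma uu_hasSum (μ : ℝ) (z : ℂ) (hz : ‖z‖ < 1) :
    HasSum (fun j => uu μ j * z ^ j) (1 / (1 - z) ^ (μ : ℂ)) := by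
  have := (Complex.one_div_one_sub_cpow_hasFPowerSeriesOnBall_zero (μ : ℂ)).hasSum (y := z)
    (by simpa [Metric.mem_eball, edist_zero_right, enorm_eq_nnnorm, ← NNReal.coe_lt_coe] using hz)
  simpa [uu, FormalMultilinearSeries.ofScalars_apply_eq, mul_comm] using this

open PowerSeries in
lemma gegenbauer_eq_conv (μ t : ℝ) (hμ : 0 < μ) (w v : ℂ) (hwv : w * v = 1)
    (hs : w + v = 2 * t) (l : ℕ) :
    (gegenbauer μ l t : ℂ) = ∑ p ∈ Finset.HasAntidiagonal.antidiagonal l, (uu μ p.1 * w ^ p.1) * (uu μ p.2 * v ^ p.2) := by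
  have key : ∀ w : ℂ, ∀ A : PowerSeries ℂ, A = PowerSeries.mk (fun j => uu μ j * w ^ j) →
      (1 - C w * X) * PowerSeries.derivative ℂ A = C ((μ : ℂ) * w) * A := by
    intro w A hA
    ext j
    rw [sub_mul, one_mul, mul_assoc, map_sub, coeff_C_mul, coeff_C_mul, hA]
    rcases j with _ | j
    · have := uu_succ μ 0
      simp only [coeff_zero_X_mul, PowerSeries.coeff_derivative, coeff_mk]
      push_cast at *
      linear_combination w * this
    · have := uu_succ μ (j + 1)
      simp only [coeff_succ_X_mul, PowerSeries.coeff_derivative, coeff_mk]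
      push_cast at *
      linear_combination w ^ (j + 2) * this
  set A := PowerSeries.mk (fun j => uu μ j * w ^ j) with hA
  set A' := PowerSeries.mk (fun j => uu μ j * v ^ j) with hA'
  set B := A * A' with hB
  have hBl : ∀ l, coeff l B = ∑ p ∈ Finset.HasAntidiagonal.antidiagonal l, (uu μ p.1 * w ^ p.1) * (uu μ p.2 * v ^ p.2) := by
    intro l; simp [hB, hA, hA', coeff_mul]
  have hwvC : (C w * C v : PowerSeries ℂ) = 1 := by rw [← map_mul, hwv, map_one]
  have hsC : (C w + C v : PowerSeries ℂ) = C (2 * t : ℂ) := by rw [← map_add, hs]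
  have ode : PowerSeries.derivative ℂ B - C (2 * t : ℂ) * (X * PowerSeries.derivative ℂ B) + X * (X * PowerSeries.derivative ℂ B)
      = C (2 * μ * t : ℂ) * B - C (2 * μ : ℂ) * (X * B) := by
    have h1 := key w A hA
    have h2 := key v A' hA'
    have h3 : PowerSeries.derivative ℂ B = A * PowerSeries.derivative ℂ A' + A' * PowerSeries.derivative ℂ A := by
      rw [hB, Derivation.leibniz]; simp
    have e1 : C (2 * μ * t : ℂ) = C (μ : ℂ) * (C w + C v) := by
      rw [hsC, ← map_mul]; congr 1; ring
    have e2 : C (2 * μ : ℂ) = 2 * C (μ : ℂ) := by rw [map_mul, map_ofNat]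
    rw [map_mul] at h1 h2
    rw [h3, e1, e2, ← hsC]
    linear_combination (1 - C w * X) * A * h2 + (1 - C v * X) * A' * h1 + (-X ^ 2 * (A * PowerSeries.derivative ℂ A' + A' * PowerSeries.derivative ℂ A) -2 * C (μ : ℂ) * X * A * A') * hwvC
  have hrec : ∀ l : ℕ, ((l : ℂ) + 2) * coeff (l + 2) B = 2 * (l + 1 + μ) * t * coeff (l + 1) B
      - (l + 2 * μ) * coeff l B := by
    intro l
    have := congrArg (coeff (l + 1)) ode
    rcases l with _ | l
    · simp only [map_add, map_sub, coeff_C_mul, coeff_succ_X_mul, PowerSeries.coeff_derivative,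
        zero_add, coeff_zero_X_mul] at this
      push_cast at this ⊢
      simp only [zero_add]
      linear_combination this
    · simp only [map_add, map_sub, coeff_C_mul, coeff_succ_X_mul, PowerSeries.coeff_derivative] at this
      push_cast at *
      linear_combination this
  rw [← hBl]
  have u1 := uu_succ μ 0
  simp only [uu_zero] at u1
  norm_num at u1
  induction l using Nat.strong_induction_on with
  | _ l ih =>
    rcases l with _ | _ | l
    · rw [hBl, gegenbauer_zero _ _ hμ]; simp [uu_zero]
    · rw [hBl, gegenbauer_one _ _ hμ]
      simp [Finset.Nat.antidiagonal_succ, uu_zero, u1]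
      linear_combination -(μ : ℂ) * hs
    · have h1 := ih (l + 1) (by omega)
      have h0 := ih l (by omega)
      have hr := gegenbauer_rec μ t hμ l
      have hr' := congrArg (fun x : ℝ => (x : ℂ)) hr
      push_cast at hr'
      rw [h1, h0, ← hrec l] at hr'
      refine mul_left_cancel₀ ?_ hr'
      exact_mod_cast (by positivity : ((l : ℝ) + 2) ≠ 0)

noncomputable def acoef (lam t : ℝ) (l : ℕ) : ℝ := (lam + l) / lam * gegenbauer lam l t

lemma gegenbauer_hasSum (μ t : ℝ) (hμ : 0 < μ) (w v : ℂ) (hwv : w * v = 1)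
    (hs : w + v = 2 * t) (hw : ‖w‖ = 1) (hv : ‖v‖ = 1) (ρ : ℂ) (hρ : ‖ρ‖ < 1) :
    HasSum (fun l => (gegenbauer μ l t : ℂ) * ρ ^ l)
      (1 / (1 - w * ρ) ^ (μ : ℂ) * (1 / (1 - v * ρ) ^ (μ : ℂ))) := by
  have h1 := uu_hasSum μ (w * ρ) (by rwa [norm_mul, hw, one_mul])
  have h2 := uu_hasSum μ (v * ρ) (by rwa [norm_mul, hv, one_mul])
  have n1 := h1.summable.norm
  have n2 := h2.summable.norm
  rw [← h1.tsum_eq, ← h2.tsum_eq, tsum_mul_tsum_eq_tsum_sum_antidiagonal_of_summable_norm n1 n2]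
  have := (summable_norm_sum_mul_antidiagonal_of_summable_norm n1 n2).of_norm.hasSum
  refine Eq.subst (motive := fun f => HasSum f _) ?_ this
  funext l
  symm
  rw [gegenbauer_eq_conv μ t hμ w v hwv hs, Finset.sum_mul]
  apply Finset.sum_congr rfl
  intro p hp
  rw [← Finset.HasAntidiagonal.mem_antidiagonal.1 hp, pow_add, mul_pow, mul_pow]
  ring

lemma acoef_hasSum (lam t : ℝ) (hl : 0 < lam) (w v : ℂ) (hwv : w * v = 1)
    (hs : w + v = 2 * t) (hw : ‖w‖ = 1) (hv : ‖v‖ = 1) (ρ : ℂ) (hρ : ‖ρ‖ < 1) :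
    HasSum (fun l => (acoef lam t l : ℂ) * ρ ^ l)
      ((1 - ρ ^ 2) * (1 / (1 - w * ρ) ^ ((lam + 1 : ℝ) : ℂ) * (1 / (1 - v * ρ) ^ ((lam + 1 : ℝ) : ℂ)))) := by
  have h := gegenbauer_hasSum (lam + 1) t (by linarith) w v hwv hs hw hv ρ hρ
  set P := 1 / (1 - w * ρ) ^ ((lam + 1 : ℝ) : ℂ) * (1 / (1 - v * ρ) ^ ((lam + 1 : ℝ) : ℂ))
  have h2 := (hasSum_nat_add_iff' 2).2 h
  have h3 := h2.sub (h.mul_left (ρ ^ 2))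
  rw [← hasSum_nat_add_iff' 2]
  convert h3 using 1
  · funext l
    have := congrArg (fun x : ℝ => (x : ℂ)) (gegenbauer_up lam t hl l)
    simp only [acoef]
    push_cast at this ⊢
    rw [this]; ring
  · have e0 : acoef lam t 0 = 1 := by
      simp [acoef, gegenbauer_zero lam t hl, hl.ne']
    have e1 : acoef lam t 1 = 2 * (lam + 1) * t := by
      simp [acoef, gegenbauer_one lam t hl]; field_simp
    simp only [Finset.sum_range_succ, Finset.sum_range_zero, e0, e1,
      gegenbauer_zero (lam + 1) t (by linarith), gegenbauer_one (lam + 1) t (by linarith)]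
    push_cast
    ring

lemma exists_w (t : ℝ) (h1 : -1 ≤ t) (h2 : t ≤ 1) : ∃ w v : ℂ, w * v = 1 ∧ w + v = 2 * t ∧
    ‖w‖ = 1 ∧ ‖v‖ = 1 := by
  refine ⟨Complex.exp (Real.arccos t * Complex.I), Complex.exp (-(Real.arccos t * Complex.I)),
    ?_, ?_, ?_, ?_⟩
  · rw [← Complex.exp_add]; simp
  · have := Complex.two_cos (Real.arccos t : ℂ)
    rw [← Complex.ofReal_cos, Real.cos_arccos h1 h2] at this
    rw [this]; simp
  · exact Complex.norm_exp_ofReal_mul_I _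
  · have := Complex.norm_exp_ofReal_mul_I (-Real.arccos t)
    simpa using this

lemma acoef_summable (lam t : ℝ) (hl : 0 < lam) (h1 : -1 ≤ t) (h2 : t ≤ 1) (ρ : ℂ) (hρ : ‖ρ‖ < 1) :
    Summable (fun l => (acoef lam t l : ℂ) * ρ ^ l) := by
  obtain ⟨w, v, hwv, hs, hw, hv⟩ := exists_w t h1 h2
  exact (acoef_hasSum lam t hl w v hwv hs hw hv ρ hρ).summable

lemma acoef_bound (lam t : ℝ) (hl : 0 < lam) (h1 : -1 ≤ t) (h2 : t ≤ 1) (r : ℝ) (hr0 : 0 < r)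
    (hr1 : r < 1) (ρ : ℂ) (hρ : ‖ρ - r‖ ≤ (1 - r) / 2) :
    ‖∑' l, (acoef lam t l : ℂ) * ρ ^ l‖ ≤
      3 * (1 - r) * ((1 - 2 * r * t + r ^ 2) / 4) ^ (-(lam + 1)) := by
  obtain ⟨w, v, hwv, hs, hw, hv⟩ := exists_w t h1 h2
  have hn : ‖ρ‖ < 1 := by
    have := norm_add_le (ρ - r) (r : ℂ)
    rw [sub_add_cancel, Complex.norm_real, Real.norm_of_nonneg hr0.le] at this
    linarith
  rw [(acoef_hasSum lam t hl w v hwv hs hw hv ρ hn).tsum_eq]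
  have key : ∀ w : ℂ, ‖w‖ = 1 → ‖1 - w * r‖ / 2 ≤ ‖1 - w * ρ‖ ∧ 1 - r ≤ ‖1 - w * r‖ := by
    intro w hw
    have a1 := norm_sub_norm_le (1 : ℂ) (w * r)
    rw [norm_mul, hw, Complex.norm_real, Real.norm_of_nonneg hr0.le, norm_one] at a1
    have a2 := norm_sub_norm_le (1 - w * r) (w * (ρ - r))
    rw [norm_mul, hw] at a2
    have : 1 - w * r - w * (ρ - r) = 1 - w * ρ := by ring
    rw [this] at a2
    constructor <;> linarith
  obtain ⟨kw1, kw2⟩ := key w hw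
  obtain ⟨kv1, kv2⟩ := key v hv
  have hD : ‖1 - w * r‖ * ‖1 - v * r‖ = 1 - 2 * r * t + r ^ 2 := by
    rw [← norm_mul]
    have : (1 - w * r) * (1 - v * r) = ((1 - 2 * r * t + r ^ 2 : ℝ) : ℂ) := by
      push_cast
      linear_combination (r : ℂ) ^ 2 * hwv - (r : ℂ) * hs
    rw [this, Complex.norm_real, Real.norm_of_nonneg]
    nlinarith [sq_nonneg (1 - r)]
  have hDpos : 0 < 1 - 2 * r * t + r ^ 2 := by
    rw [← hD]; apply mul_pos <;> linarith
  have hprod : (1 - 2 * r * t + r ^ 2) / 4 ≤ ‖1 - w * ρ‖ * ‖1 - v * ρ‖ := by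
    rw [← hD]
    have := mul_le_mul kw1 kv1 (by positivity) (by positivity)
    linarith
  have hq : ‖1 - ρ ^ 2‖ ≤ 3 * (1 - r) := by
    have e : 1 - ρ ^ 2 = (1 - ρ) * (1 + ρ) := by ring
    rw [e, norm_mul]
    have b1 : ‖1 - ρ‖ ≤ 3 / 2 * (1 - r) := by
      have := norm_sub_le ((1 - r : ℝ) : ℂ) (ρ - r)
      rw [Complex.norm_real, Real.norm_of_nonneg (by linarith)] at this
      have e : ((1 - r : ℝ) : ℂ) - (ρ - r) = 1 - ρ := by push_cast; ring
      rw [e] at this; linarith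
    have b2 : ‖1 + ρ‖ ≤ 2 := by
      have := norm_add_le 1 ρ
      rw [norm_one] at this; linarith
    have := mul_le_mul b1 b2 (norm_nonneg _) (by linarith)
    linarith
  rw [norm_mul, norm_mul, norm_div, norm_div, Complex.norm_cpow_real, Complex.norm_cpow_real,
    norm_one]
  have : 1 / ‖1 - w * ρ‖ ^ (lam + 1) * (1 / ‖1 - v * ρ‖ ^ (lam + 1)) =
      (‖1 - w * ρ‖ * ‖1 - v * ρ‖) ^ (-(lam + 1)) := by
    rw [Real.rpow_neg (by positivity), Real.mul_rpow (norm_nonneg _) (norm_nonneg _)]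
    field_simp
  rw [this]
  apply mul_le_mul hq _ (by positivity) (by linarith)
  exact Real.rpow_le_rpow_of_nonpos (by linarith) hprod (by linarith)

section Cauchy

variable (a : ℕ → ℂ)

lemma summable_poly (ha : ∀ ρ : ℂ, ‖ρ‖ < 1 → Summable (fun l => a l * ρ ^ l)) (j : ℕ) (s : ℝ)
    (hs : 0 < s) : Summable (fun l : ℕ => ‖a l‖ * (l : ℝ) ^ j * Real.exp (-(l * s))) := by
  have hq : Real.exp (-(s / 2)) < 1 := by rw [Real.exp_lt_one_iff]; linarith
  have h1 := (ha (Real.exp (-(s / 2)) : ℝ) (by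
    rw [Complex.norm_real, Real.norm_of_nonneg (Real.exp_pos _).le]; exact hq)).norm
  have h2 : Summable (fun l : ℕ => (l : ℝ) ^ j * Real.exp (-(s / 2)) ^ l) :=
    summable_pow_mul_geometric_of_norm_lt_one j (by
      rw [Real.norm_of_nonneg (Real.exp_pos _).le]; exact hq)
  have h3 := h1.mul_of_nonneg h2 (fun _ => by positivity) (fun _ => by positivity)
  have h4 := h3.comp_injective (i := fun l : ℕ => (l, l)) (fun x y h => by simpa using h)
  refine h4.congr (fun l => ?_)
  simp only [Function.comp, norm_mul, norm_pow, Complex.norm_real,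
    Real.norm_of_nonneg (Real.exp_pos _).le]
  rw [← Real.exp_nat_mul]
  have : Real.exp (-(l * s)) = Real.exp (l * -(s / 2)) * Real.exp (l * -(s / 2)) := by
    rw [← Real.exp_add]; congr 1; ring
  rw [this]; ring

noncomputable def HH (j : ℕ) (z : ℂ) : ℂ := ∑' l : ℕ, a l * (-(l : ℂ)) ^ j * Complex.exp (-(l * z))

lemma HH_term_norm (j l : ℕ) (z : ℂ) : ‖a l * (-(l : ℂ)) ^ j * Complex.exp (-(l * z))‖ =
    ‖a l‖ * (l : ℝ) ^ j * Real.exp (-(l * z.re)) := by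
  rw [norm_mul, norm_mul, norm_pow, norm_neg, Complex.norm_natCast, Complex.norm_exp]
  simp

lemma HH_summable (ha : ∀ ρ : ℂ, ‖ρ‖ < 1 → Summable (fun l => a l * ρ ^ l)) (j : ℕ) (z : ℂ)
    (hz : 0 < z.re) :
    Summable (fun l : ℕ => a l * (-(l : ℂ)) ^ j * Complex.exp (-(l * z))) := by
  apply Summable.of_norm
  simp_rw [HH_term_norm]
  exact summable_poly a ha j _ hz

lemma HH_deriv (ha : ∀ ρ : ℂ, ‖ρ‖ < 1 → Summable (fun l => a l * ρ ^ l)) (j : ℕ) (z : ℂ)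
    (hz : 0 < z.re) : HasDerivAt (HH a j) (HH a (j + 1) z) z := by
  have hop : IsOpen {y : ℂ | z.re / 2 < y.re} := isOpen_lt continuous_const Complex.continuous_re
  have hzm : z ∈ {y : ℂ | z.re / 2 < y.re} := by simp only [mem_ofPred_eq]; linarith
  refine hasDerivAt_tsum_of_isPreconnected
    (g := fun (l : ℕ) (z : ℂ) => a l * (-(l : ℂ)) ^ j * Complex.exp (-(l * z)))
    (g' := fun (l : ℕ) (z : ℂ) => a l * (-(l : ℂ)) ^ (j + 1) * Complex.exp (-(l * z)))
    (summable_poly a ha (j + 1) (z.re / 2) (by linarith)) hop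
    (convex_halfSpace_re_gt _).isPreconnected ?_ ?_ hzm (HH_summable a ha j z hz) hzm
  · intro l y _
    have h1 : HasDerivAt (fun y : ℂ => -((l : ℂ) * y)) (-(l : ℂ)) y := by
      simpa using (hasDerivAt_id y).const_mul (-(l : ℂ))
    have := (h1.cexp).const_mul (a l * (-(l : ℂ)) ^ j)
    refine this.congr_deriv ?_
    ring
  · intro l y hy
    rw [HH_term_norm]
    have hy' : z.re / 2 ≤ y.re := le_of_lt hy
    gcongr

lemma HH_iter (ha : ∀ ρ : ℂ, ‖ρ‖ < 1 → Summable (fun l => a l * ρ ^ l)) (j : ℕ) : ∀ (z : ℂ)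
    (_ : 0 < z.re), iteratedDeriv j (HH a 0) z = HH a j z := by
  induction j with
  | zero => intro z _; simp
  | succ j ih =>
    intro z hz
    rw [iteratedDeriv_succ]
    have hop : IsOpen {y : ℂ | 0 < y.re} := isOpen_lt continuous_const Complex.continuous_re
    have : iteratedDeriv j (HH a 0) =ᶠ[nhds z] HH a j := by
      filter_upwards [hop.mem_nhds hz] with y hy using ih y hy
    rw [this.deriv_eq, (HH_deriv a ha j z hz).deriv]

lemma HH_bound (ha : ∀ ρ : ℂ, ‖ρ‖ < 1 → Summable (fun l => a l * ρ ^ l)) (x M : ℝ) (hx : 0 < x)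
    (hM : ∀ ρ : ℂ, ‖ρ - Real.exp (-x)‖ ≤ (1 - Real.exp (-x)) / 2 → ‖∑' l, a l * ρ ^ l‖ ≤ M)
    (j : ℕ) : ‖HH a j x‖ ≤ j.factorial * M / (x / 2) ^ j := by
  rw [← HH_iter a ha j x (by simpa using hx)]
  apply Complex.norm_iteratedDeriv_le_of_forall_mem_sphere_norm_le j (by linarith)
  · apply DifferentiableOn.diffContOnCl
    intro z hz
    rw [closure_ball _ (by positivity)] at hz
    have h1 : |(z - x).re| ≤ x / 2 := (Complex.abs_re_le_norm _).trans (by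
      simpa [dist_eq_norm] using hz)
    rw [Complex.sub_re, Complex.ofReal_re] at h1
    have h2 := (abs_le.1 h1).1
    exact (HH_deriv a ha 0 z (by linarith)).differentiableAt.differentiableWithinAt
  · intro z hz
    have e : HH a 0 z = ∑' l, a l * (Complex.exp (-z)) ^ l := by
      unfold HH
      congr 1; funext l
      rw [← Complex.exp_nat_mul]; simp
    rw [e]
    apply hM
    have e2 : Complex.exp (-z) - (Real.exp (-x) : ℝ) = (Real.exp (-x) : ℝ) * (Complex.exp (-(z - x)) - 1) := by
      push_cast
      rw [mul_sub, ← Complex.exp_add]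
      congr 2 <;> ring_nf
    have hn : ‖-(z - x)‖ = x / 2 := by
      rw [norm_neg]; simpa [dist_eq_norm] using hz
    have h3 : ‖Complex.exp (-(z - x)) - 1‖ ≤ Real.exp (x / 2) - 1 := by
      have := Complex.norm_exp_sub_sum_le_exp_norm_sub_sum (-(z - x)) 1
      rw [hn] at this
      simpa using this
    rw [e2, norm_mul, Complex.norm_real, Real.norm_of_nonneg (Real.exp_pos _).le]
    have h4 := mul_le_mul_of_nonneg_left h3 (Real.exp_pos (-x)).le
    have e3 : Real.exp (-x) = Real.exp (-(x / 2)) * Real.exp (-(x / 2)) := by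
      rw [← Real.exp_add]; congr 1; ring
    have e4 : Real.exp (-(x / 2)) * Real.exp (x / 2) = 1 := by
      rw [← Real.exp_add]; simp
    have e5 : Real.exp (-(x / 2)) ≤ 1 := by rw [Real.exp_le_one_iff]; linarith
    have e6 : Real.exp (-x) * (Real.exp (x / 2) - 1) =
        Real.exp (-(x / 2)) - Real.exp (-(x / 2)) * Real.exp (-(x / 2)) := by
      rw [e3]; linear_combination Real.exp (-(x / 2)) * e4
    rw [e6] at h4
    refine h4.trans ?_
    rw [e3]
    nlinarith [sq_nonneg (1 - Real.exp (-(x / 2)))]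

end Cauchy

noncomputable def phi (N : ℕ) (s : ℝ) : ℝ :=
  Real.exp (-s) * ∑ j ∈ Finset.range N, s ^ j / (j.factorial : ℝ)

lemma phi_deriv (N : ℕ) (s : ℝ) :
    HasDerivAt (phi (N + 1)) (-(Real.exp (-s) * (s ^ N / (N.factorial : ℝ)))) s := by
  have he : HasDerivAt (fun s : ℝ => Real.exp (-s)) (-Real.exp (-s)) s := by
    simpa using (hasDerivAt_neg s).exp
  induction N with
  | zero =>
    have : phi (0 + 1) = fun s => Real.exp (-s) := by funext s; simp [phi]
    rw [this]
    simpa using he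
  | succ N ih =>
    have : phi (N + 1 + 1) = fun s => phi (N + 1) s +
        Real.exp (-s) * (s ^ (N + 1) / ((N + 1).factorial : ℝ)) := by
      funext s; simp only [phi]; rw [Finset.sum_range_succ]; ring
    rw [this]
    have h1 : HasDerivAt (fun s : ℝ => s ^ (N + 1) / ((N + 1).factorial : ℝ))
        (((N + 1 : ℕ) : ℝ) * s ^ N / ((N + 1).factorial : ℝ)) s := by
      simpa using (hasDerivAt_pow (N + 1) s).div_const ((N + 1).factorial : ℝ)
    refine (ih.add (he.mul h1)).congr_deriv ?_
    rw [Nat.factorial_succ]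
    have : (N.factorial : ℝ) ≠ 0 := by positivity
    push_cast
    field_simp
    ring

lemma phi_tendsto (N : ℕ) : Tendsto (phi N) atTop (nhds 0) := by
  have : phi N = fun s => ∑ j ∈ Finset.range N, s ^ j * Real.exp (-s) / (j.factorial : ℝ) := by
    funext s; simp only [phi]; rw [Finset.mul_sum]
    apply Finset.sum_congr rfl; intros; ring
  rw [this]
  have h : Tendsto (fun s => ∑ j ∈ Finset.range N, s ^ j * Real.exp (-s) / (j.factorial : ℝ)) atTop
      (nhds (∑ j ∈ Finset.range N, 0 / (j.factorial : ℝ))) :=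
    tendsto_finsetSum _ (fun j _ => (Real.tendsto_pow_mul_exp_neg_atTop_nhds_zero j).div_const _)
  simpa using h

lemma coef_eq (m : ℕ) (hm : 1 ≤ m) (ψ : ℝ → ℝ)
    (hψ : ∀ t : ℝ, ψ t = 2 ^ m / Real.sqrt (Real.Gamma (2 * m)) * t ^ m * Real.exp (-t))
    (R L : ℝ) (hR : 0 ≤ R) (hL : 0 < L) :
    ∫ a in Ioi R, |ψ (a * L)| ^ 2 / a = phi (2 * m) (2 * R * L) := by
  obtain ⟨M, rfl⟩ : ∃ M, m = M + 1 := ⟨m - 1, by omega⟩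
  have hΓ : Real.Gamma (2 * ((M + 1 : ℕ) : ℝ)) = ((2 * M + 1).factorial : ℝ) := by
    rw [← Real.Gamma_nat_eq_factorial]; congr 1; push_cast; ring
  have h1 : ∀ a ∈ Ioi R, |ψ (a * L)| ^ 2 / a = Real.exp (-(2 * a * L)) *
      ((2 * a * L) ^ (2 * M + 1) / ((2 * M + 1).factorial : ℝ)) * (2 * L) := by
    intro a ha
    have ha0 : 0 < a := lt_of_le_of_lt hR ha
    rw [sq_abs, hψ, hΓ, mul_pow, mul_pow, div_pow, Real.sq_sqrt (by positivity)]
    have : Real.exp (-(2 * a * L)) = Real.exp (-(a * L)) ^ 2 := by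
      rw [← Real.exp_nat_mul]; congr 1; push_cast; ring
    rw [this]
    have : ((2 * M + 1).factorial : ℝ) ≠ 0 := by positivity
    field_simp
    ring
  rw [setIntegral_congr_fun measurableSet_Ioi h1]
  have hd : ∀ a : ℝ, HasDerivAt (fun a => - phi (2 * M + 1 + 1) (2 * a * L))
      (Real.exp (-(2 * a * L)) *
      ((2 * a * L) ^ (2 * M + 1) / ((2 * M + 1).factorial : ℝ)) * (2 * L)) a := by
    intro a
    have h2 : HasDerivAt (fun a : ℝ => 2 * a * L) (2 * L) a := by
      simpa using ((hasDerivAt_id a).const_mul 2).mul_const L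
    have h3 := (phi_deriv (2 * M + 1) (2 * a * L)).comp a h2
    refine (h3.neg).congr_deriv ?_
    ring
  have ht : Tendsto (fun a => - phi (2 * M + 1 + 1) (2 * a * L)) atTop (nhds 0) := by
    have h4 : Tendsto (fun a : ℝ => 2 * a * L) atTop atTop :=
      (tendsto_id.const_mul_atTop (by norm_num : (0 : ℝ) < 2)).atTop_mul_const hL
    simpa using ((phi_tendsto (2 * M + 1 + 1)).comp h4).neg
  rw [integral_Ioi_of_hasDerivAt_of_nonneg' (fun a _ => hd a) ?_ ht]
  · simp [mul_add]
  · intro a ha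
    have ha0 : 0 < a := lt_of_le_of_lt hR ha
    positivity

lemma HH_real (b : ℕ → ℝ) (x : ℝ) (j l : ℕ) :
    (-(x : ℂ)) ^ j / (j.factorial : ℂ) *
      ((b l : ℂ) * (-(l : ℂ)) ^ j * Complex.exp (-(l * (x : ℂ)))) =
    ((b l * (Real.exp (-(x * l)) * ((x * l) ^ j / (j.factorial : ℝ))) : ℝ) : ℂ) := by
  push_cast
  have : (-(x : ℂ)) ^ j * (-(l : ℂ)) ^ j = ((x : ℂ) * l) ^ j := by
    rw [← mul_pow]; congr 1; ring
  rw [← this, mul_comm (x : ℂ) (l : ℂ)]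
  ring

lemma phi_sum_bound (b : ℕ → ℝ) (x M : ℝ) (N : ℕ) (hN : 1 ≤ N) (hx : 0 < x)
    (ha : ∀ ρ : ℂ, ‖ρ‖ < 1 → Summable (fun l => (b l : ℂ) * ρ ^ l))
    (hM : ∀ ρ : ℂ, ‖ρ - Real.exp (-x)‖ ≤ (1 - Real.exp (-x)) / 2 →
      ‖∑' l, (b l : ℂ) * ρ ^ l‖ ≤ M) :
    |∑' l : ℕ, b (l + 1) * phi N (x * (l + 1 : ℕ))| ≤ (∑ j ∈ Finset.range N, 2 ^ j) * M + |b 0| := by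
  have hx' : 0 < (x : ℂ).re := by simpa using hx
  have h1 : HasSum (fun l : ℕ => ∑ j ∈ Finset.range N, (-(x : ℂ)) ^ j / (j.factorial : ℂ) *
      ((b l : ℂ) * (-(l : ℂ)) ^ j * Complex.exp (-(l * (x : ℂ)))))
      (∑ j ∈ Finset.range N, (-(x : ℂ)) ^ j / (j.factorial : ℂ) * HH (fun l => (b l : ℂ)) j x) :=
    hasSum_sum (fun j _ => (HH_summable (fun l => (b l : ℂ)) ha j x hx').hasSum.mul_left _)
  have h2 : (fun l : ℕ => ∑ j ∈ Finset.range N, (-(x : ℂ)) ^ j / (j.factorial : ℂ) *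
      ((b l : ℂ) * (-(l : ℂ)) ^ j * Complex.exp (-(l * (x : ℂ))))) =
      fun l : ℕ => ((b l * phi N (x * l) : ℝ) : ℂ) := by
    funext l
    simp_rw [HH_real]
    rw [phi, Finset.mul_sum, Finset.mul_sum]
    push_cast
    rfl
  rw [h2] at h1
  have h3 := (hasSum_nat_add_iff' 1).2 h1
  have h4 : phi N (x * ((0 : ℕ) : ℝ)) = 1 := by
    obtain ⟨K, rfl⟩ : ∃ K, N = K + 1 := ⟨N - 1, by omega⟩
    simp [phi, Finset.sum_range_succ']
  rw [Finset.sum_range_one, h4, mul_one] at h3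
  have h5 := h3.tsum_eq
  rw [← Complex.ofReal_tsum] at h5
  rw [← Real.norm_eq_abs, ← Complex.norm_real, h5]
  refine (norm_sub_le _ _).trans ?_
  rw [Complex.norm_real, Real.norm_eq_abs]
  gcongr
  rw [Finset.sum_mul]
  refine norm_sum_le_of_le _ (fun j _ => ?_)
  rw [norm_mul, norm_div, norm_pow, norm_neg, Complex.norm_real, Real.norm_of_nonneg hx.le,
    Complex.norm_natCast]
  have := HH_bound (fun l => (b l : ℂ)) ha x M hx hM j
  have hf : (0 : ℝ) < j.factorial := by positivity
  calc x ^ j / (j.factorial : ℝ) * ‖HH (fun l => (b l : ℂ)) j x‖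
      ≤ x ^ j / (j.factorial : ℝ) * (j.factorial * M / (x / 2) ^ j) := by gcongr
    _ = 2 ^ j * M := by
      rw [div_pow]; field_simp

lemma pointwise_bound (lam r t : ℝ) (hl : 1 / 2 ≤ lam) (hr0 : 0 < r) (hr1 : r < 1) (h1 : -1 ≤ t)
    (h2 : t ≤ 1) :
    ((1 - 2 * r * t + r ^ 2) / 4) ^ (-(lam + 1)) * (1 - t ^ 2) ^ (lam - 1 / 2) ≤
      16 ^ (lam - 1 / 2) * 16 ^ (3 / 2 : ℝ) * ((1 - r) ^ 2 + (1 - t)) ^ (-(3 / 2 : ℝ)) := by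
  set D := 1 - 2 * r * t + r ^ 2 with hD
  have hD1 : (1 - r) ^ 2 ≤ D := by nlinarith
  have hD2 : (1 - t) / 2 ≤ D := by
    rcases le_total 0 t with h | h
    · nlinarith [sq_nonneg (r - t)]
    · nlinarith
  have hDpos : 0 < D := lt_of_lt_of_le (by nlinarith) hD1
  have hE : 0 < (1 - r) ^ 2 + (1 - t) := by nlinarith
  have e1 : (1 - t ^ 2) ^ (lam - 1 / 2) ≤ (16 * (D / 4)) ^ (lam - 1 / 2) :=
    Real.rpow_le_rpow (by nlinarith) (by nlinarith) (by linarith)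
  have e2 : (D / 4) ^ (-(3 / 2 : ℝ)) ≤ (((1 - r) ^ 2 + (1 - t)) / 16) ^ (-(3 / 2 : ℝ)) :=
    Real.rpow_le_rpow_of_nonpos (by positivity) (by linarith) (by norm_num)
  have hD4 : 0 < D / 4 := by positivity
  calc (D / 4) ^ (-(lam + 1)) * (1 - t ^ 2) ^ (lam - 1 / 2)
      ≤ (D / 4) ^ (-(lam + 1)) * (16 * (D / 4)) ^ (lam - 1 / 2) := by gcongr
    _ = 16 ^ (lam - 1 / 2) * (D / 4) ^ (-(3 / 2 : ℝ)) := by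
      rw [Real.mul_rpow (by norm_num) hD4.le, mul_left_comm, ← Real.rpow_add hD4]
      congr 2; ring
    _ ≤ 16 ^ (lam - 1 / 2) * (((1 - r) ^ 2 + (1 - t)) / 16) ^ (-(3 / 2 : ℝ)) := by gcongr
    _ = _ := by
      rw [Real.div_rpow hE.le (by norm_num), Real.rpow_neg (by norm_num : (0 : ℝ) ≤ 16)]
      field_simp

lemma integral_bound (e : ℝ) (he : 0 < e) :
    IntervalIntegrable (fun t : ℝ => e * (e ^ 2 + (1 - t)) ^ (-(3 / 2 : ℝ))) volume (-1) 1 ∧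
    ∫ t in (-1 : ℝ)..1, e * (e ^ 2 + (1 - t)) ^ (-(3 / 2 : ℝ)) ≤ 2 := by
  have hpos : ∀ t ∈ uIcc (-1 : ℝ) 1, 0 < e ^ 2 + (1 - t) := by
    intro t ht
    rw [uIcc_of_le (by norm_num)] at ht
    have := ht.2
    have : 0 < e ^ 2 := by positivity
    linarith
  have hi : IntervalIntegrable (fun t : ℝ => e * (e ^ 2 + (1 - t)) ^ (-(3 / 2 : ℝ))) volume (-1) 1 := by
    apply ContinuousOn.intervalIntegrable
    apply ContinuousOn.mul continuousOn_const
    apply ContinuousOn.rpow_const (by fun_prop)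
    intro t ht
    exact Or.inl (hpos t ht).ne'
  refine ⟨hi, ?_⟩
  have hd : ∀ t ∈ uIcc (-1 : ℝ) 1, HasDerivAt (fun t : ℝ => 2 * e * (e ^ 2 + (1 - t)) ^ (-(1 / 2 : ℝ)))
      (e * (e ^ 2 + (1 - t)) ^ (-(3 / 2 : ℝ))) t := by
    intro t ht
    have h1 : HasDerivAt (fun t : ℝ => e ^ 2 + (1 - t)) (-1) t := by
      simpa using ((hasDerivAt_id t).const_sub 1).const_add (e ^ 2)
    have h2 := (h1.rpow_const (p := -(1 / 2 : ℝ)) (Or.inl (hpos t ht).ne')).const_mul (2 * e)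
    refine h2.congr_deriv ?_
    rw [show -(1 / 2 : ℝ) - 1 = -(3 / 2) by norm_num]
    ring
  rw [intervalIntegral.integral_eq_sub_of_hasDerivAt hd hi]
  have e1 : (e ^ 2 + (1 - 1)) ^ (-(1 / 2 : ℝ)) = e⁻¹ := by
    rw [sub_self, add_zero, ← Real.rpow_natCast, ← Real.rpow_mul he.le]
    norm_num
    exact Real.rpow_neg_one e
  rw [e1]
  have : 0 ≤ 2 * e * (e ^ 2 + (1 - -1)) ^ (-(1 / 2 : ℝ)) := by positivity
  have : 2 * e * e⁻¹ = 2 := by field_simp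
  linarith

/-- the normalized Poisson wavelets with symbol
`ψ_m(t) = (2^m/√Γ(2m)) t^m e^{-t}` satisfy both (bilinear) wavelet admissibility
conditions. -/
theorem stmt16 (n m : ℕ) (hn : 2 ≤ n) (hm : 1 ≤ m)
    (ψ : ℝ → ℝ)
    (hψ : ∀ t : ℝ, ψ t = 2 ^ m / Real.sqrt (Real.Gamma (2 * m)) * t ^ m * Real.exp (-t)) :
    (∫ t in Ioi (0 : ℝ), |ψ t| ^ 2 / t = 1) ∧
    (∃ c : ℝ, ∀ R : ℝ, 0 < R →
      ∫ t in (-1 : ℝ)..1,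
        |∑' l : ℕ, ((lamb n + (l + 1 : ℕ)) / lamb n) *
            (∫ a in Ioi R, |ψ (a * (l + 1 : ℕ))| ^ 2 / a) *
            gegenbauer (lamb n) (l + 1) t| *
          (1 - t ^ 2) ^ (lamb n - 1 / 2) ≤ c) := by
  constructor
  · have h := coef_eq m hm ψ hψ 0 1 le_rfl one_pos
    simp only [mul_one, mul_zero] at h
    rw [h]
    obtain ⟨K, hK⟩ : ∃ K, 2 * m = K + 1 := ⟨2 * m - 1, by omega⟩
    rw [hK]
    simp [phi, Finset.sum_range_succ']
  · have hlam : 1 / 2 ≤ lamb n := by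
      have : (2 : ℝ) ≤ n := by exact_mod_cast hn
      unfold lamb; linarith
    have hl0 : 0 < lamb n := by linarith
    set lam := lamb n with hlamdef
    set S : ℝ := ∑ j ∈ Finset.range (2 * m), 2 ^ j with hS
    have hS0 : 0 ≤ S := by positivity
    set K : ℝ := S * 3 * (16 ^ (lam - 1 / 2) * 16 ^ (3 / 2 : ℝ)) with hK
    have hK0 : 0 ≤ K := by positivity
    refine ⟨K * 2 + 2, fun R hR => ?_⟩
    set r := Real.exp (-(2 * R)) with hr
    have hr0 : 0 < r := Real.exp_pos _
    have hr1 : r < 1 := by rw [hr, Real.exp_lt_one_iff]; linarith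
    obtain ⟨hi, hb⟩ := integral_bound (1 - r) (by linarith)
    have hpt : ∀ t ∈ Ioc (-1 : ℝ) 1, |∑' l : ℕ, ((lam + (l + 1 : ℕ)) / lam) *
            (∫ a in Ioi R, |ψ (a * (l + 1 : ℕ))| ^ 2 / a) *
            gegenbauer lam (l + 1) t| * (1 - t ^ 2) ^ (lam - 1 / 2) ≤
        K * ((1 - r) * ((1 - r) ^ 2 + (1 - t)) ^ (-(3 / 2 : ℝ))) + 1 := by
      intro t ht
      have h1 : -1 ≤ t := ht.1.le
      have h2 := ht.2
      have hsum : (∑' l : ℕ, ((lam + (l + 1 : ℕ)) / lam) *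
            (∫ a in Ioi R, |ψ (a * (l + 1 : ℕ))| ^ 2 / a) * gegenbauer lam (l + 1) t) =
          ∑' l : ℕ, acoef lam t (l + 1) * phi (2 * m) (2 * R * (l + 1 : ℕ)) := by
        congr 1; funext l
        rw [coef_eq m hm ψ hψ R (l + 1 : ℕ) hR.le (by positivity), acoef]
        ring
      rw [hsum]
      have hB := phi_sum_bound (acoef lam t) (2 * R)
        (3 * (1 - r) * ((1 - 2 * r * t + r ^ 2) / 4) ^ (-(lam + 1))) (2 * m) (by omega)
        (by linarith) (acoef_summable lam t hl0 h1 h2)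
        (fun ρ hρ => acoef_bound lam t hl0 h1 h2 r hr0 hr1 ρ hρ)
      have e0 : acoef lam t 0 = 1 := by
        simp [acoef, gegenbauer_zero lam t hl0, hl0.ne']
      rw [e0, abs_one] at hB
      have hw0 : 0 ≤ (1 - t ^ 2) ^ (lam - 1 / 2) := Real.rpow_nonneg (by nlinarith) _
      have hw1 : (1 - t ^ 2) ^ (lam - 1 / 2) ≤ 1 :=
        Real.rpow_le_one (by nlinarith) (by nlinarith) (by linarith)
      have hP := pointwise_bound lam r t hlam hr0 hr1 h1 h2
      refine (mul_le_mul_of_nonneg_right hB hw0).trans ?_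
      have hc : 0 ≤ S * (3 * (1 - r)) := mul_nonneg hS0 (by linarith)
      have := mul_le_mul_of_nonneg_left hP hc
      rw [hK]
      linarith
    have hint2 : IntervalIntegrable (fun t : ℝ =>
        K * ((1 - r) * ((1 - r) ^ 2 + (1 - t)) ^ (-(3 / 2 : ℝ))) + 1) volume (-1) 1 :=
      (hi.const_mul K).add intervalIntegrable_const
    calc _ ≤ ∫ t in (-1 : ℝ)..1, (K * ((1 - r) * ((1 - r) ^ 2 + (1 - t)) ^ (-(3 / 2 : ℝ))) + 1) := by
          rw [intervalIntegral.integral_of_le (by norm_num),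
            intervalIntegral.integral_of_le (by norm_num)]
          apply integral_mono_of_nonneg
          · filter_upwards [ae_restrict_mem measurableSet_Ioc] with t ht
            have h1 := ht.1
            have h2 := ht.2
            exact mul_nonneg (abs_nonneg _) (Real.rpow_nonneg (by nlinarith) _)
          · exact (intervalIntegrable_iff_integrableOn_Ioc_of_le (by norm_num)).1 hint2
          · filter_upwards [ae_restrict_mem measurableSet_Ioc] with t ht using hpt t ht
      _ = K * (∫ t in (-1 : ℝ)..1, (1 - r) * ((1 - r) ^ 2 + (1 - t)) ^ (-(3 / 2 : ℝ))) + 2 := by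
          rw [intervalIntegral.integral_add (hi.const_mul K) intervalIntegrable_const,
            intervalIntegral.integral_const_mul]
          simp
          norm_num
      _ ≤ K * 2 + 2 := by gcongr
end

section
/- Let n ≥ 2 be an integer, λ = (n-1)/2, m ∈ ℕ, and γ_m(t) = t^m e^{-t}/Γ(m). Then the normalized Poisson wavelets G̃_a^m(t) = Σ_{l=0}^∞ ((λ+l)/λ) γ_m(al) C_l^λ(t) satisfy both linear wavelet admissibility conditions: (1) for every integer l ≥ 1, ∫₀^∞ γ_m(al) da/a = 1 (so that ∫₀^∞ ((λ+l)/λ)γ_m(al) da/a = (λ+l)/λ); and (2) there exists a constant c, independent of R, such that for every R > 0, ∫_{-1}^1 |Σ_{l=1}^∞ ((λ+l)/λ) (∫_R^∞ γ_m(al) da/a) C_l^λ(t)| (1-t²)^{λ-1/2} dt ≤ c. -/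
open Real MeasureTheory Set Filter
open scoped RealInnerProductSpace BigOperators

lemma choose_rec (a : ℂ) (j : ℕ) :
    ((j : ℂ) + 1) * Ring.choose a (j + 1) = (a - j) * Ring.choose a j := by
  rw [Ring.choose_eq_smul, Ring.choose_eq_smul, descPochhammer_succ_right,
    Polynomial.smeval_mul, Nat.factorial_succ]
  have : (j.factorial : ℂ) ≠ 0 := by exact_mod_cast Nat.factorial_ne_zero j
  have h2 : (j : ℂ) + 1 ≠ 0 := by exact_mod_cast Nat.succ_ne_zero j
  simp [Polynomial.smeval_sub, Polynomial.smeval_natCast]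
  field_simp

lemma binom_hasSum (a x : ℂ) (hx : ‖x‖ < 1) :
    HasSum (fun j : ℕ => Ring.choose a j * x ^ j) ((1 + x) ^ a) := by
  have h := (Complex.one_add_cpow_hasFPowerSeriesOnBall_zero (a := a)).hasSum (y := x)
    (by simpa [Metric.mem_eball, edist_eq_enorm_sub, enorm_eq_nnnorm, ← NNReal.coe_lt_one] using hx)
  rw [zero_add] at h
  have e : (fun j : ℕ => Ring.choose a j * x ^ j) =
      (fun j => (binomialSeries ℂ a j) fun _ => x) := by
    funext j
    rw [binomialSeries_apply]
    simp
  rw [e]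
  exact h

noncomputable def dco (a c d : ℂ) (l : ℕ) : ℂ :=
  ∑ p ∈ Finset.HasAntidiagonal.antidiagonal l, (Ring.choose a p.1 * c ^ p.1) * (Ring.choose a p.2 * d ^ p.2)

lemma dco_hasSum (a c d z : ℂ) (hc : ‖c‖ = 1) (hd : ‖d‖ = 1) (hz : ‖z‖ < 1) :
    HasSum (fun l : ℕ => dco a c d l * z ^ l) ((1 + c * z) ^ a * (1 + d * z) ^ a) := by
  have h1 := binom_hasSum a (c * z) (by simpa [hc] using hz)
  have h2 := binom_hasSum a (d * z) (by simpa [hd] using hz)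
  have n1 := h1.summable.norm
  have n2 := h2.summable.norm
  have e := tsum_mul_tsum_eq_tsum_sum_antidiagonal_of_summable_norm n1 n2
  have s := (summable_norm_sum_mul_antidiagonal_of_summable_norm n1 n2).of_norm
  rw [h1.tsum_eq, h2.tsum_eq] at e
  rw [e]
  have e2 : (fun l : ℕ => dco a c d l * z ^ l) = fun l => ∑ p ∈ Finset.HasAntidiagonal.antidiagonal l,
      (Ring.choose a p.1 * (c * z) ^ p.1) * (Ring.choose a p.2 * (d * z) ^ p.2) := by
    funext l
    simp only [dco, Finset.sum_mul]
    refine Finset.sum_congr rfl fun p hp => ?_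
    rw [← Finset.HasAntidiagonal.mem_antidiagonal.1 hp]
    ring
  rw [e2]
  exact s.hasSum

lemma dco_rec (a c d : ℂ) (hcd : c * d = 1) (l : ℕ) :
    ((l : ℂ) + 2) * dco a c d (l + 2) =
      (c + d) * (a - l - 1) * dco a c d (l + 1) + (2 * a - l) * dco a c d l := by
  let A (c : ℂ) : PowerSeries ℂ := PowerSeries.mk fun j => Ring.choose a j * c ^ j
  have ode (c : ℂ) : (1 + PowerSeries.C c * PowerSeries.X) * PowerSeries.derivative ℂ (A c)
      = PowerSeries.C (a * c) * A c := by
    ext j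
    rcases j with _ | j
    · have := choose_rec a 0
      simp at this
      rw [add_mul, one_mul, map_add, mul_assoc, PowerSeries.coeff_C_mul, PowerSeries.coeff_C_mul,
        PowerSeries.coeff_zero_X_mul, PowerSeries.coeff_derivative]
      simp [A]
    · have := choose_rec a (j + 1)
      push_cast at this
      simp [A, add_mul, mul_assoc, PowerSeries.coeff_derivative, PowerSeries.coeff_succ_X_mul]
      linear_combination (c ^ (j + 2)) * this
  have hco (l : ℕ) : dco a c d l = PowerSeries.coeff l (A c * A d) := by
    simp [PowerSeries.coeff_mul, dco, A]
  have key : (1 + PowerSeries.C (c + d) * PowerSeries.X + PowerSeries.X * PowerSeries.X) *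
      PowerSeries.derivative ℂ (A c * A d) =
      PowerSeries.C (a * (c + d)) * (A c * A d) + PowerSeries.C (2 * a) * (PowerSeries.X * (A c * A d)) := by
    have h1 := ode c
    have h2 := ode d
    have h3 : (PowerSeries.C c * PowerSeries.C d : PowerSeries ℂ) = 1 := by
      rw [← map_mul, hcd, map_one]
    have h4 : (PowerSeries.C 2 : PowerSeries ℂ) = 2 := map_ofNat _ 2
    rw [Derivation.leibniz]
    simp only [map_mul, map_add, smul_eq_mul, h4] at h1 h2 ⊢
    linear_combination (1 + PowerSeries.C d * PowerSeries.X) * A d * h1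
      + (1 + PowerSeries.C c * PowerSeries.X) * A c * h2
      + (2 * PowerSeries.C a * PowerSeries.X * A c * A d - PowerSeries.X * PowerSeries.X * (A c * PowerSeries.derivative ℂ (A d) + A d * PowerSeries.derivative ℂ (A c))) * h3
  have hk := congrArg (PowerSeries.coeff (l + 1)) key
  simp only [hco]
  generalize A c * A d = f at *
  have ex (g : PowerSeries ℂ) (c : ℂ) (j : ℕ) : PowerSeries.coeff (j + 1) (PowerSeries.C c * PowerSeries.X * g) = c * PowerSeries.coeff j g := by
    rw [mul_assoc, PowerSeries.coeff_C_mul, PowerSeries.coeff_succ_X_mul]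
  rw [add_mul, add_mul, one_mul, map_add (PowerSeries.coeff (l + 1)), map_add (PowerSeries.coeff (l + 1)),
    map_add (PowerSeries.coeff (l + 1)), ex, PowerSeries.coeff_C_mul,
    PowerSeries.coeff_C_mul, PowerSeries.coeff_succ_X_mul, mul_assoc,
    PowerSeries.coeff_succ_X_mul, PowerSeries.coeff_derivative, PowerSeries.coeff_derivative] at hk
  rcases l with _ | l
  · simp only [PowerSeries.coeff_zero_X_mul] at hk
    push_cast at hk ⊢
    linear_combination hk
  · rw [PowerSeries.coeff_succ_X_mul, PowerSeries.coeff_derivative] at hk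
    push_cast at hk ⊢
    linear_combination hk

lemma dco_zero (a c d : ℂ) : dco a c d 0 = 1 := by simp [dco]

lemma dco_one (a c d : ℂ) : dco a c d 1 = a * (c + d) := by
  have h : Finset.HasAntidiagonal.antidiagonal 1 = {(0, 1), (1, 0)} := rfl
  simp [dco, h]
  ring

noncomputable def gco (lam : ℝ) (l k : ℕ) : ℝ :=
  if 2 * k ≤ l then (-1 : ℝ) ^ k * Real.Gamma ((l : ℝ) - (k : ℝ) + lam) /
      (Real.Gamma lam * (Nat.factorial k : ℝ) * (Nat.factorial (l - 2 * k) : ℝ)) else 0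

lemma geg_eq (lam : ℝ) (l N : ℕ) (hN : l / 2 + 1 ≤ N) (t : ℝ) :
    gegenbauer lam l t = ∑ k ∈ Finset.range N, gco lam l k * (2 * t) ^ (l - 2 * k) := by
  rw [gegenbauer]
  have hs : Finset.range (l / 2 + 1) ⊆ Finset.range N := Finset.range_subset_range.2 hN
  rw [← Finset.sum_subset hs]
  · refine Finset.sum_congr rfl fun k hk => ?_
    have : 2 * k ≤ l := by have := Finset.mem_range.1 hk; omega
    rw [gco, if_pos this]
  · intro k _ hk
    have : ¬ 2 * k ≤ l := by
      intro h; apply hk; rw [Finset.mem_range]; omega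
    rw [gco, if_neg this, zero_mul]

lemma geg_zero (lam : ℝ) (h : 0 < lam) (t : ℝ) : gegenbauer lam 0 t = 1 := by
  have := (Real.Gamma_pos_of_pos h).ne'
  simp [gegenbauer, this]

lemma geg_one (lam : ℝ) (h : 0 < lam) (t : ℝ) : gegenbauer lam 1 t = 2 * lam * t := by
  have := (Real.Gamma_pos_of_pos h).ne'
  simp [gegenbauer, add_comm 1 lam, Real.Gamma_add_one h.ne']
  field_simp

/-- three-term recurrence, coefficientwise -/
lemma gco_rec (lam : ℝ) (h : 0 < lam) (l k : ℕ) :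
    ((l : ℝ) + 2) * gco lam (l + 2) (k + 1) =
      ((l : ℝ) + 1 + lam) * gco lam (l + 1) (k + 1) - (l + 2 * lam) * gco lam l k := by
  have hG := (Real.Gamma_pos_of_pos h).ne'
  have hk : (k.factorial : ℝ) ≠ 0 := by exact_mod_cast Nat.factorial_ne_zero k
  have hk1 : (k : ℝ) + 1 ≠ 0 := by positivity
  unfold gco
  by_cases h1 : 2 * k ≤ l
  · obtain ⟨q, rfl⟩ := Nat.exists_eq_add_of_le h1
    have hq : (q.factorial : ℝ) ≠ 0 := by exact_mod_cast Nat.factorial_ne_zero q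
    rw [if_pos (by omega), if_pos (by omega : 2 * k ≤ 2 * k + q)]
    have e1 : 2 * k + q + 2 - 2 * (k + 1) = q := by omega
    have e2 : 2 * k + q - 2 * k = q := by omega
    have g1 : ((2 * k + q + 2 : ℕ) : ℝ) - ((k + 1 : ℕ) : ℝ) + lam = (k + q + lam) + 1 := by
      push_cast; ring
    have g2 : ((2 * k + q : ℕ) : ℝ) - (k : ℝ) + lam = k + q + lam := by
      push_cast; ring
    have g3 : ((2 * k + q + 1 : ℕ) : ℝ) - ((k + 1 : ℕ) : ℝ) + lam = k + q + lam := by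
      push_cast; ring
    rw [e1, e2, g1, g2, g3, Real.Gamma_add_one (by positivity)]
    rcases q with _ | q
    · rw [if_neg (by omega)]
      push_cast [Nat.factorial_succ]
      field_simp
      ring
    · have e3 : 2 * k + (q + 1) + 1 - 2 * (k + 1) = q := by omega
      rw [if_pos (by omega), e3]
      have hq : (q.factorial : ℝ) ≠ 0 := by exact_mod_cast Nat.factorial_ne_zero q
      push_cast [Nat.factorial_succ]
      field_simp
      ring
  · rw [if_neg (by omega), if_neg (by omega), if_neg (by omega)]
    ring

lemma gco_rec0 (lam : ℝ) (h : 0 < lam) (l : ℕ) :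
    ((l : ℝ) + 1) * gco lam (l + 1) 0 = ((l : ℝ) + lam) * gco lam l 0 := by
  have hG := (Real.Gamma_pos_of_pos h).ne'
  have hl : (l.factorial : ℝ) ≠ 0 := by exact_mod_cast Nat.factorial_ne_zero l
  have hl1 : (l : ℝ) + 1 ≠ 0 := by positivity
  have g1 : ((l + 1 : ℕ) : ℝ) - ((0 : ℕ) : ℝ) + lam = (l + lam) + 1 := by push_cast; ring
  unfold gco
  rw [if_pos (by omega), if_pos (by omega), g1, Real.Gamma_add_one (by positivity)]
  simp [Nat.factorial_succ]
  field_simp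

lemma geg_rec (lam : ℝ) (h : 0 < lam) (l : ℕ) (t : ℝ) :
    ((l : ℝ) + 2) * gegenbauer lam (l + 2) t =
      2 * t * ((l : ℝ) + 1 + lam) * gegenbauer lam (l + 1) t
        - (l + 2 * lam) * gegenbauer lam l t := by
  rw [geg_eq lam (l + 2) (l + 5 + 1) (by omega), geg_eq lam (l + 1) (l + 5 + 1) (by omega),
    geg_eq lam l (l + 5) (by omega), Finset.sum_range_succ', Finset.sum_range_succ' _ (l + 5)]
  have h0 := gco_rec0 lam h (l + 1)
  push_cast at h0
  have hs : ∀ k ∈ Finset.range (l + 5),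
      ((l : ℝ) + 2) * (gco lam (l + 2) (k + 1) * (2 * t) ^ (l + 2 - 2 * (k + 1))) =
      2 * t * ((l : ℝ) + 1 + lam) * (gco lam (l + 1) (k + 1) * (2 * t) ^ (l + 1 - 2 * (k + 1)))
      - (l + 2 * lam) * (gco lam l k * (2 * t) ^ (l - 2 * k)) := by
    intro k _
    have e1 : l + 2 - 2 * (k + 1) = l - 2 * k := by omega
    have r := gco_rec lam h l k
    rw [e1]
    by_cases h1 : 2 * k + 1 ≤ l
    · have e2 : l - 2 * k = (l + 1 - 2 * (k + 1)) + 1 := by omega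
      rw [e2, pow_succ]
      linear_combination ((2 * t) ^ (l + 1 - 2 * (k + 1)) * (2 * t)) * r
    · have : gco lam (l + 1) (k + 1) = 0 := by rw [gco, if_neg (by omega)]
      rw [this] at r ⊢
      linear_combination (2 * t) ^ (l - 2 * k) * r
  have hs' := Finset.sum_congr rfl hs
  rw [Finset.sum_sub_distrib, ← Finset.mul_sum, ← Finset.mul_sum, ← Finset.mul_sum] at hs'
  simp only [mul_zero, Nat.sub_zero]
  rw [mul_add, mul_add, hs']
  linear_combination ((2 * t) ^ (l + 1) * (2 * t)) * h0

lemma gco_shift (lam : ℝ) (h : 0 < lam) (l k : ℕ) :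
    gco (lam + 1) (l + 2) (k + 1) - gco (lam + 1) l k
      = (lam + ((l + 2 : ℕ) : ℝ)) / lam * gco lam (l + 2) (k + 1) := by
  have hG := (Real.Gamma_pos_of_pos h).ne'
  have hk : (k.factorial : ℝ) ≠ 0 := by exact_mod_cast Nat.factorial_ne_zero k
  have hk1 : (k : ℝ) + 1 ≠ 0 := by positivity
  unfold gco
  by_cases h1 : 2 * k ≤ l
  · obtain ⟨q, rfl⟩ := Nat.exists_eq_add_of_le h1
    have hq : (q.factorial : ℝ) ≠ 0 := by exact_mod_cast Nat.factorial_ne_zero q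
    rw [if_pos (by omega), if_pos (by omega : 2 * k ≤ 2 * k + q), if_pos (by omega)]
    have e1 : 2 * k + q + 2 - 2 * (k + 1) = q := by omega
    have e2 : 2 * k + q - 2 * k = q := by omega
    have g1 : ((2 * k + q + 2 : ℕ) : ℝ) - ((k + 1 : ℕ) : ℝ) + (lam + 1) = (k + q + lam + 1) + 1 := by
      push_cast; ring
    have g2 : ((2 * k + q : ℕ) : ℝ) - (k : ℝ) + (lam + 1) = k + q + lam + 1 := by
      push_cast; ring
    have g3 : ((2 * k + q + 2 : ℕ) : ℝ) - ((k + 1 : ℕ) : ℝ) + lam = k + q + lam + 1 := by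
      push_cast; ring
    rw [e1, e2, g1, g2, g3, Real.Gamma_add_one (by positivity : (k + q + lam + 1 : ℝ) ≠ 0),
      Real.Gamma_add_one h.ne']
    push_cast [Nat.factorial_succ]
    field_simp
    ring
  · rw [if_neg (by omega), if_neg (by omega), if_neg (by omega)]
    ring

lemma gco_shift0 (lam : ℝ) (h : 0 < lam) (l : ℕ) :
    gco (lam + 1) l 0 = (lam + (l : ℝ)) / lam * gco lam l 0 := by
  have hG := (Real.Gamma_pos_of_pos h).ne'
  have hl : (l.factorial : ℝ) ≠ 0 := by exact_mod_cast Nat.factorial_ne_zero l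
  have g1 : (l : ℝ) - ((0 : ℕ) : ℝ) + (lam + 1) = (l + lam) + 1 := by push_cast; ring
  unfold gco
  rw [if_pos (by omega), if_pos (by omega), g1, Real.Gamma_add_one (by positivity),
    Real.Gamma_add_one h.ne']
  simp
  field_simp
  ring

lemma geg_shift (lam : ℝ) (h : 0 < lam) (l : ℕ) (t : ℝ) :
    gegenbauer (lam + 1) (l + 2) t - gegenbauer (lam + 1) l t
      = (lam + ((l + 2 : ℕ) : ℝ)) / lam * gegenbauer lam (l + 2) t := by
  rw [geg_eq _ (l + 2) (l + 5 + 1) (by omega), geg_eq lam (l + 2) (l + 5 + 1) (by omega),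
    geg_eq _ l (l + 5) (by omega), Finset.sum_range_succ', Finset.sum_range_succ' _ (l + 5),
    gco_shift0 lam h, mul_add, Finset.mul_sum, add_sub_right_comm, ← Finset.sum_sub_distrib]
  congr 1
  · refine Finset.sum_congr rfl fun k _ => ?_
    have e1 : l + 2 - 2 * (k + 1) = l - 2 * k := by omega
    rw [e1]
    linear_combination (2 * t) ^ (l - 2 * k) * gco_shift lam h l k
  · ring

lemma dco_eq_geg (mu : ℝ) (h : 0 < mu) (c d : ℂ) (t : ℝ) (hcd : c * d = 1)
    (hs : c + d = -2 * (t : ℂ)) (l : ℕ) :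
    dco (-(mu : ℂ)) c d l = ((gegenbauer mu l t : ℝ) : ℂ) := by
  induction l using Nat.twoStepInduction with
  | zero => rw [dco_zero, geg_zero mu h]; simp
  | one => rw [dco_one, geg_one mu h, hs]; push_cast; ring
  | more l ih1 ih2 =>
    have r := dco_rec (-(mu : ℂ)) c d hcd l
    have g := congrArg (fun x : ℝ => (x : ℂ)) (geg_rec mu h l t)
    push_cast at g
    have hl : (l : ℂ) + 2 ≠ 0 := by exact_mod_cast (by omega : l + 2 ≠ 0)
    apply mul_left_cancel₀ hl
    rw [r, g, ih1, ih2, hs]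
    ring

lemma gen_hasSum (lam : ℝ) (h : 0 < lam) (c d z : ℂ) (t : ℝ) (hcd : c * d = 1)
    (hs : c + d = -2 * (t : ℂ)) (hc : ‖c‖ = 1) (hd : ‖d‖ = 1) (hz : ‖z‖ < 1) :
    HasSum (fun l : ℕ => (((lam + l) / lam * gegenbauer lam l t : ℝ) : ℂ) * z ^ l)
      ((1 - z ^ 2) * ((1 + c * z) ^ (-((lam + 1 : ℝ) : ℂ)) * (1 + d * z) ^ (-((lam + 1 : ℝ) : ℂ)))) := by
  have h1 := dco_hasSum (-((lam + 1 : ℝ) : ℂ)) c d z hc hd hz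
  simp only [dco_eq_geg (lam + 1) (by positivity) c d t hcd hs] at h1
  set S := (1 + c * z) ^ (-((lam + 1 : ℝ) : ℂ)) * (1 + d * z) ^ (-((lam + 1 : ℝ) : ℂ))
  have h2 := (hasSum_nat_add_iff' 2).2 h1
  have h3 := h2.sub (h1.mul_left (z ^ 2))
  rw [← hasSum_nat_add_iff' 2]
  convert h3 using 1
  · funext l
    have g := congrArg (fun x : ℝ => (x : ℂ)) (geg_shift lam h l t)
    simp only [← g]
    push_cast
    ring
  · simp only [Finset.sum_range_succ, Finset.sum_range_zero, geg_zero lam h, geg_one lam h,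
      geg_zero (lam + 1) (by positivity), geg_one (lam + 1) (by positivity)]
    have : (lam : ℂ) ≠ 0 := by exact_mod_cast h.ne'
    push_cast
    field_simp
    ring

/-- termwise differentiation of Dirichlet-type series -/
lemma iter_hasSum (e : ℕ → ℂ) (Φ : ℂ → ℂ)
    (h0 : ∀ w : ℂ, 0 < w.re → HasSum (fun l : ℕ => e l * Complex.exp (-(l * w))) (Φ w)) (k : ℕ) :
    ∀ w : ℂ, 0 < w.re →
      HasSum (fun l : ℕ => e l * (-(l : ℂ)) ^ k * Complex.exp (-(l * w))) (iteratedDeriv k Φ w) := by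
  induction k with
  | zero => intro w hw; simpa using h0 w hw
  | succ k ih =>
    intro w hw
    set δ := w.re / 2
    have hδ : 0 < δ := by positivity
    let U : Set ℂ := {v | δ < v.re}
    have hU : IsOpen U := isOpen_lt continuous_const Complex.continuous_re
    have hwU : w ∈ U := by change δ < w.re; simp only [δ]; linarith
    have hu := (ih (δ : ℂ) (by simpa using hδ)).summable.norm
    have key := Complex.hasSum_deriv_of_summable_norm hu
      (F := fun (l : ℕ) v => e l * (-(l : ℂ)) ^ k * Complex.exp (-(l * v))) (U := U)
      (fun i => by fun_prop) hU (by
        intro i v hv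
        simp only [norm_mul, Complex.norm_exp]
        have : (-(↑i * v) : ℂ).re ≤ (-(↑i * (δ : ℂ)) : ℂ).re := by
          simp
          have : δ ≤ v.re := le_of_lt hv
          gcongr
        gcongr) hwU
    have heq : (fun v : ℂ => ∑' i : ℕ, e i * (-(i : ℂ)) ^ k * Complex.exp (-(i * v)))
        =ᶠ[nhds w] iteratedDeriv k Φ := by
      filter_upwards [hU.mem_nhds hwU] with v hv
      exact (ih v (lt_trans hδ hv)).tsum_eq
    rw [heq.deriv_eq] at key
    rw [iteratedDeriv_succ]
    convert! key using 1
    funext l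
    have hd : HasDerivAt (fun v : ℂ => e l * (-(l : ℂ)) ^ k * Complex.exp (-(l * v)))
        (e l * (-(l : ℂ)) ^ k * (Complex.exp (-(l * w)) * (-(l * 1)))) w :=
      ((((hasDerivAt_id w).const_mul (l : ℂ)).neg).cexp).const_mul _
    rw [hd.deriv]
    ring

noncomputable def Phi (mu : ℝ) (c d : ℂ) (w : ℂ) : ℂ :=
  (1 - Complex.exp (-w) ^ 2) * ((1 + c * Complex.exp (-w)) ^ (-(mu : ℂ)) *
    (1 + d * Complex.exp (-w)) ^ (-(mu : ℂ)))

lemma slit_aux (c w : ℂ) (hc : ‖c‖ = 1) (hw : 0 < w.re) :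
    1 + c * Complex.exp (-w) ∈ Complex.slitPlane := by
  left
  have h1 : ‖c * Complex.exp (-w)‖ < 1 := by
    rw [norm_mul, hc, one_mul, Complex.norm_exp]
    simpa using hw
  have h2 := Complex.abs_re_le_norm (c * Complex.exp (-w))
  have h3 := abs_le.1 h2
  simp only [Complex.add_re, Complex.one_re]
  linarith [h3.1]

lemma Phi_diff (mu : ℝ) (c d : ℂ) (hc : ‖c‖ = 1) (hd : ‖d‖ = 1) (w : ℂ) (hw : 0 < w.re) :
    DifferentiableAt ℂ (Phi mu c d) w := by
  unfold Phi
  have h1 : DifferentiableAt ℂ (fun w => (1 + c * Complex.exp (-w)) ^ (-(mu : ℂ))) w :=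
    DifferentiableAt.cpow_const (by fun_prop) (slit_aux c w hc hw)
  have h2 : DifferentiableAt ℂ (fun w => (1 + d * Complex.exp (-w)) ^ (-(mu : ℂ))) w :=
    DifferentiableAt.cpow_const (by fun_prop) (slit_aux d w hd hw)
  fun_prop

lemma fac_bound (c z : ℂ) (r q : ℝ) (hc : ‖c‖ = 1) (hz : ‖z‖ ≤ q)
    (hzr : ‖z - r‖ ≤ 1 - q) : ‖1 + c * r‖ ≤ 2 * ‖1 + c * z‖ := by
  have h1 : ‖1 + c * r‖ ≤ ‖1 + c * z‖ + ‖z - r‖ := by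
    have : 1 + c * (r : ℂ) = (1 + c * z) - c * (z - r) := by ring
    rw [this]
    refine (norm_sub_le _ _).trans ?_
    rw [norm_mul, hc, one_mul]
  have h2 : 1 - ‖z‖ ≤ ‖1 + c * z‖ := by
    have := norm_sub_le (1 + c * z) (c * z)
    simp only [add_sub_cancel_right, norm_one, norm_mul, hc, one_mul] at this
    linarith
  linarith

lemma Phi_bound (mu : ℝ) (hmu : 0 < mu) (c d : ℂ) (t R : ℝ) (hR : 0 < R) (hcd : c * d = 1)
    (hs : c + d = -2 * (t : ℂ)) (hc : ‖c‖ = 1) (hd : ‖d‖ = 1) (w : ℂ) (hw : ‖w - R‖ = R / 2)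
    (D : ℝ) (hD : D = 1 - 2 * Real.exp (-R) * t + Real.exp (-R) ^ 2) (hDpos : 0 < D) :
    ‖Phi mu c d w‖ ≤ 3 * 4 ^ mu * ((1 - Real.exp (-R) ^ 2) * D ^ (-mu)) := by
  set q := Real.exp (-(R / 2)) with hq
  set r := Real.exp (-R) with hr
  have hrq : r = q ^ 2 := by rw [hr, hq, ← Real.exp_nat_mul]; congr 1; push_cast; ring
  have hq0 : 0 < q := Real.exp_pos _
  have hq1 : q < 1 := by rw [hq, Real.exp_lt_one_iff]; linarith
  set z := Complex.exp (-w) with hz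
  have hre : R / 2 ≤ w.re := by
    have := (abs_le.1 ((Complex.abs_re_le_norm (w - R)).trans hw.le)).1
    simp at this
    linarith
  have hzn : ‖z‖ ≤ q := by
    rw [hz, Complex.norm_exp, hq]
    apply Real.exp_le_exp.2
    simpa using hre
  have hzr : ‖z - r‖ ≤ q * (1 - q) := by
    have e : z - r = (r : ℂ) * (Complex.exp (-(w - R)) - 1) := by
      rw [hr, Complex.ofReal_exp, hz, mul_sub, ← Complex.exp_add]
      push_cast
      rw [mul_one]
      congr 2
      ring
    have := Complex.norm_exp_sub_sum_le_exp_norm_sub_sum (-(w - R)) 1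
    simp only [Finset.sum_range_one, pow_zero, Nat.factorial_zero, Nat.cast_one, div_one, norm_neg, hw] at this
    rw [e, norm_mul, Complex.norm_real, Real.norm_of_nonneg (Real.exp_pos _).le]
    have e2 : Real.exp (R / 2) * q = 1 := by rw [hq, ← Real.exp_add]; simp
    calc r * _ ≤ r * (Real.exp (R / 2) - 1) := by gcongr
      _ = q * (1 - q) := by rw [hrq]; linear_combination q * e2
  have hzr' : ‖z - r‖ ≤ 1 - q := hzr.trans (by nlinarith)
  have hA := fac_bound c z r q hc hzn hzr'
  have hB := fac_bound d z r q hd hzn hzr'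
  have hprod : ‖1 + c * r‖ * ‖1 + d * r‖ = D := by
    rw [← norm_mul]
    have : (1 + c * (r : ℂ)) * (1 + d * r) = (D : ℂ) := by
      rw [hD]; push_cast
      linear_combination (r : ℂ) * hs + (r : ℂ) ^ 2 * hcd
    rw [this, Complex.norm_real, Real.norm_of_nonneg hDpos.le]
  have hD4 : D / 4 ≤ ‖1 + c * z‖ * ‖1 + d * z‖ := by
    have := mul_le_mul hA hB (norm_nonneg _) (by positivity)
    linarith
  have hnum : ‖1 - z ^ 2‖ ≤ 3 * (1 - r ^ 2) := by
    have e : 1 - z ^ 2 = ((1 - r ^ 2 : ℝ) : ℂ) - (z - r) * (z + r) := by push_cast; ring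
    have hr1 : r ≤ q := by rw [hrq]; nlinarith
    have hr0 : 0 < r := Real.exp_pos _
    have h5 : ‖z + r‖ ≤ 2 := by
      refine (norm_add_le _ _).trans ?_
      rw [Complex.norm_real, Real.norm_of_nonneg hr0.le]
      linarith
    have h6 : 0 ≤ 1 - r ^ 2 := by nlinarith
    rw [e]
    refine (norm_sub_le _ _).trans ?_
    rw [norm_mul, Complex.norm_real, Real.norm_of_nonneg h6]
    have : ‖z - r‖ * ‖z + r‖ ≤ (1 - q) * 2 := mul_le_mul hzr' h5 (norm_nonneg _) (by linarith)
    have : r ^ 2 ≤ q := by nlinarith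
    linarith
  have hpow : (‖1 + c * z‖ * ‖1 + d * z‖) ^ (-mu) ≤ 4 ^ mu * D ^ (-mu) := by
    calc _ ≤ (D / 4) ^ (-mu) :=
          Real.rpow_le_rpow_of_nonpos (by positivity) hD4 (by linarith)
      _ = 4 ^ mu * D ^ (-mu) := by
          rw [Real.div_rpow hDpos.le (by norm_num), Real.rpow_neg (by norm_num : (0:ℝ) ≤ 4)]
          field_simp
  have e : ‖Phi mu c d w‖ = ‖1 - z ^ 2‖ * (‖1 + c * z‖ * ‖1 + d * z‖) ^ (-mu) := by
    rw [Phi, norm_mul, norm_mul, ← Complex.ofReal_neg, Complex.norm_cpow_real,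
      Complex.norm_cpow_real, Real.mul_rpow (norm_nonneg _) (norm_nonneg _)]
  rw [e]
  calc _ ≤ 3 * (1 - r ^ 2) * (4 ^ mu * D ^ (-mu)) := by gcongr; exact (norm_nonneg _).trans hnum
    _ = _ := by ring

lemma iter_bound (mu : ℝ) (hmu : 0 < mu) (c d : ℂ) (t R : ℝ) (hR : 0 < R) (hcd : c * d = 1)
    (hs : c + d = -2 * (t : ℂ)) (hc : ‖c‖ = 1) (hd : ‖d‖ = 1)
    (D : ℝ) (hD : D = 1 - 2 * Real.exp (-R) * t + Real.exp (-R) ^ 2) (hDpos : 0 < D) (k : ℕ) :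
    ‖iteratedDeriv k (Phi mu c d) R‖ * (R ^ k / k.factorial) ≤
      2 ^ k * (3 * 4 ^ mu * ((1 - Real.exp (-R) ^ 2) * D ^ (-mu))) := by
  have h := Complex.norm_iteratedDeriv_le_of_forall_mem_sphere_norm_le (c := (R : ℂ)) (R := R / 2)
    (f := Phi mu c d) k (by positivity) (by
      refine DifferentiableOn.diffContOnCl fun w hw => ?_
      rw [closure_ball _ (by positivity), mem_closedBall_iff_norm] at hw
      refine (Phi_diff mu c d hc hd w ?_).differentiableWithinAt
      have := (abs_le.1 ((Complex.abs_re_le_norm (w - R)).trans hw)).1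
      simp at this
      linarith) (fun w hw => Phi_bound mu hmu c d t R hR hcd hs hc hd w
        (by simpa using mem_sphere_iff_norm.1 hw) D hD hDpos)
  set M := 3 * 4 ^ mu * ((1 - Real.exp (-R) ^ 2) * D ^ (-mu))
  have hk : (0 : ℝ) < k.factorial := by exact_mod_cast Nat.factorial_pos k
  calc _ ≤ (k.factorial * M / (R / 2) ^ k) * (R ^ k / k.factorial) := by gcongr
    _ = 2 ^ k * M := by rw [div_pow]; field_simp

lemma inc_gamma (m : ℕ) (hm : 1 ≤ m) (R : ℝ) (hR : 0 ≤ R) (b : ℝ) (hb : 0 < b) :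
    ∫ a in Ioi R, ((a * b) ^ m * Real.exp (-(a * b)) / Real.Gamma m) / a =
      Real.exp (-(R * b)) * ∑ k ∈ Finset.range m, (R * b) ^ k / k.factorial := by
  obtain ⟨p, rfl⟩ : ∃ p, m = p + 1 := ⟨m - 1, by omega⟩
  have hp : (p.factorial : ℝ) ≠ 0 := by exact_mod_cast Nat.factorial_ne_zero p
  have hG : Real.Gamma ((p + 1 : ℕ) : ℝ) = p.factorial := by
    push_cast; exact Real.Gamma_nat_eq_factorial p
  rw [hG]
  have hE (p : ℕ) (x : ℝ) : HasDerivAt (fun x : ℝ => Real.exp (-x) * ∑ k ∈ Finset.range (p + 1), x ^ k / k.factorial)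
      (-(x ^ p * Real.exp (-x) / p.factorial)) x := by
    induction p with
    | zero => 
      simpa using (hasDerivAt_neg x).exp
    | succ p ih =>
      have hp : (p.factorial : ℝ) ≠ 0 := by exact_mod_cast Nat.factorial_ne_zero p
      have h2 : HasDerivAt (fun x : ℝ => Real.exp (-x) * (x ^ (p + 1) / (p + 1).factorial))
        ((Real.exp (-x) * (-1)) * (x ^ (p + 1) / (p + 1).factorial) +
          Real.exp (-x) * (((p + 1 : ℕ) : ℝ) * x ^ p / (p + 1).factorial)) x :=
        ((hasDerivAt_neg x).exp).mul ((hasDerivAt_pow (p + 1) x).div_const _)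
      have h3 := ih.add h2
      convert! h3 using 1
      · funext y
        rw [Finset.sum_range_succ, mul_add]
        rfl
      · push_cast [Nat.factorial_succ]
        field_simp
        ring
  have hlim (p : ℕ) : Tendsto (fun x : ℝ => Real.exp (-x) * ∑ k ∈ Finset.range (p + 1), x ^ k / k.factorial)
      atTop (nhds 0) := by
    simp only [Finset.mul_sum]
    rw [← Finset.sum_const_zero (s := Finset.range (p + 1)) (ι := ℕ)]
    refine tendsto_finsetSum _ fun k _ => ?_
    have := (Real.tendsto_pow_mul_exp_neg_atTop_nhds_zero k).div_const (k.factorial : ℝ)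
    simp only [zero_div] at this
    refine this.congr fun x => ?_
    ring
  have hd : ∀ a ∈ Ici R, HasDerivAt (fun a : ℝ => -(Real.exp (-(a * b)) * ∑ k ∈ Finset.range (p + 1), (a * b) ^ k / k.factorial))
      (((a * b) ^ p * Real.exp (-(a * b)) / p.factorial) * b) a := by
    intro a _
    have h1 : HasDerivAt (fun a : ℝ => a * b) b a := by
      simpa using (hasDerivAt_id a).mul_const b
    have := ((hE p (a * b)).comp a h1).neg
    convert! this using 1
    ring
  have hI := integral_Ioi_of_hasDerivAt_of_nonneg' hd (by
    intro a ha
    have : 0 < a := lt_of_le_of_lt hR ha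
    positivity) (l := 0) (by
      have := ((hlim p).comp (tendsto_id.atTop_mul_const hb)).neg
      simpa using this)
  simp only [sub_neg_eq_add, zero_add] at hI
  rw [← hI]
  refine setIntegral_congr_fun measurableSet_Ioi fun a ha => ?_
  have : a ≠ 0 := (lt_of_le_of_lt hR ha).ne'
  field_simp
  ring

lemma D_pos (r t : ℝ) (hr0 : 0 < r) (hr1 : r < 1) (ht : t ∈ Icc (-1 : ℝ) 1) :
    0 < 1 - 2 * r * t + r ^ 2 := by
  nlinarith [ht.1, ht.2, mul_nonneg hr0.le (sub_nonneg.2 ht.2), sq_pos_of_pos (sub_pos.2 hr1)]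

lemma D_int (r : ℝ) (hr0 : 0 < r) (hr1 : r < 1) :
    IntervalIntegrable (fun t : ℝ => (1 - r ^ 2) * (1 - 2 * r * t + r ^ 2) ^ (-(3 / 2) : ℝ)) volume (-1) 1 ∧
    ∫ t in (-1 : ℝ)..1, (1 - r ^ 2) * (1 - 2 * r * t + r ^ 2) ^ (-(3 / 2) : ℝ) = 2 := by
  have hu : uIcc (-1 : ℝ) 1 = Icc (-1) 1 := uIcc_of_le (by norm_num)
  have hint : IntervalIntegrable (fun t : ℝ => (1 - r ^ 2) * (1 - 2 * r * t + r ^ 2) ^ (-(3 / 2) : ℝ)) volume (-1) 1 := by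
    apply ContinuousOn.intervalIntegrable
    rw [hu]
    refine continuousOn_const.mul (ContinuousOn.rpow_const (by fun_prop) fun t ht => Or.inl (D_pos r t hr0 hr1 ht).ne')
  refine ⟨hint, ?_⟩
  have hd : ∀ t ∈ uIcc (-1 : ℝ) 1, HasDerivAt
      (fun t : ℝ => (1 - r ^ 2) / r * (1 - 2 * r * t + r ^ 2) ^ (-(1 / 2) : ℝ))
      ((1 - r ^ 2) * (1 - 2 * r * t + r ^ 2) ^ (-(3 / 2) : ℝ)) t := by
    intro t ht
    rw [hu] at ht
    have h1 : HasDerivAt (fun t : ℝ => 1 - 2 * r * t + r ^ 2) (-(2 * r)) t := by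
      have := (((hasDerivAt_id t).const_mul (2 * r)).const_sub 1).add_const (r ^ 2)
      simpa using this
    have h2 := (h1.rpow_const (p := (-(1 / 2) : ℝ)) (Or.inl (D_pos r t hr0 hr1 ht).ne')).const_mul ((1 - r ^ 2) / r)
    convert! h2 using 1
    rw [show (-(1 / 2) - 1 : ℝ) = -(3 / 2) by norm_num]
    field_simp
  rw [intervalIntegral.integral_eq_sub_of_hasDerivAt hd hint]
  have e1 : 1 - 2 * r * 1 + r ^ 2 = (1 - r) ^ 2 := by ring
  have e2 : 1 - 2 * r * (-1) + r ^ 2 = (1 + r) ^ 2 := by ring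
  have p (x : ℝ) (hx : 0 < x) : (x ^ 2) ^ (-(1 / 2) : ℝ) = x⁻¹ := by
    rw [← Real.rpow_natCast, ← Real.rpow_mul hx.le, ← Real.rpow_neg_one]
    norm_num
  rw [e1, e2, p _ (by linarith), p _ (by linarith)]
  have : 1 - r ≠ 0 := by linarith
  have : 1 + r ≠ 0 := by linarith
  field_simp
  ring

lemma weight_bound (lam r t : ℝ) (hl : 1 / 2 ≤ lam) (hr0 : 0 < r) (hr1 : r < 1) (ht : t ∈ Icc (-1 : ℝ) 1) :
    (1 - 2 * r * t + r ^ 2) ^ (-(lam + 1)) * (1 - t ^ 2) ^ (lam - 1 / 2) ≤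
      (1 - 2 * r * t + r ^ 2) ^ (-(3 / 2) : ℝ) := by
  have hD := D_pos r t hr0 hr1 ht
  have h0 : 0 ≤ 1 - t ^ 2 := by nlinarith [ht.1, ht.2]
  calc _ ≤ (1 - 2 * r * t + r ^ 2) ^ (-(lam + 1)) * (1 - 2 * r * t + r ^ 2) ^ (lam - 1 / 2) := by
        gcongr
        nlinarith [sq_nonneg (t - r)]
    _ = _ := by rw [← Real.rpow_add hD]; congr 1; ring

lemma sum_bound (lam : ℝ) (h : 0 < lam) (m : ℕ) (hm : 1 ≤ m) (t R : ℝ) (ht : t ∈ Icc (-1 : ℝ) 1)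
    (hR : 0 < R) :
    |∑' l : ℕ, ((lam + (l + 1 : ℕ)) / lam) *
        (Real.exp (-(R * (l + 1 : ℕ))) * ∑ k ∈ Finset.range m, (R * (l + 1 : ℕ)) ^ k / k.factorial) *
        gegenbauer lam (l + 1) t| ≤
      (∑ k ∈ Finset.range m, (2 : ℝ) ^ k) * (3 * 4 ^ (lam + 1) * ((1 - Real.exp (-R) ^ 2) *
        (1 - 2 * Real.exp (-R) * t + Real.exp (-R) ^ 2) ^ (-(lam + 1)))) + 1 := by
  have h0 : 0 ≤ 1 - t ^ 2 := by nlinarith [ht.1, ht.2]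
  set s := Real.sqrt (1 - t ^ 2)
  have hs2 : s ^ 2 = 1 - t ^ 2 := Real.sq_sqrt h0
  set c : ℂ := -(t : ℂ) + s * Complex.I with hcdef
  set d : ℂ := -(t : ℂ) - s * Complex.I with hddef
  have hs2' : (s : ℂ) ^ 2 = 1 - (t : ℂ) ^ 2 := by exact_mod_cast hs2
  have hcd : c * d = 1 := by
    rw [hcdef, hddef]
    linear_combination hs2' - (s : ℂ) ^ 2 * Complex.I_sq
  have hs : c + d = -2 * (t : ℂ) := by rw [hcdef, hddef]; ring
  have hc : ‖c‖ = 1 := by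
    have h1 : ‖c‖ ^ 2 = 1 := by
      rw [Complex.sq_norm, Complex.normSq_apply]
      simp [hcdef]
      nlinarith [hs2]
    nlinarith [norm_nonneg c]
  have hd : ‖d‖ = 1 := by
    have := congrArg norm hcd
    rw [norm_mul, hc, one_mul, norm_one] at this
    exact this
  have hr1 : Real.exp (-R) < 1 := by rw [Real.exp_lt_one_iff]; linarith
  have hDpos := D_pos (Real.exp (-R)) t (Real.exp_pos _) hr1 ht
  let e : ℕ → ℂ := fun l => (((lam + l) / lam * gegenbauer lam l t : ℝ) : ℂ)
  have hb : ∀ w : ℂ, 0 < w.re → HasSum (fun l : ℕ => e l * Complex.exp (-(l * w)))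
      (Phi (lam + 1) c d w) := by
    intro w hw
    have hz : ‖Complex.exp (-w)‖ < 1 := by
      rw [Complex.norm_exp]; simpa using hw
    have := gen_hasSum lam h c d (Complex.exp (-w)) t hcd hs hc hd hz
    unfold Phi
    convert! this using 2 with l
    rw [← Complex.exp_nat_mul, mul_neg]
  have hk (k : ℕ) := (iter_hasSum e _ hb k (R : ℂ) (by simpa using hR)).mul_right
    (((-R) ^ k / k.factorial : ℝ) : ℂ)
  have hS := hasSum_sum (s := Finset.range m) fun k _ => hk k
  set T := ∑ k ∈ Finset.range m, iteratedDeriv k (Phi (lam + 1) c d) R * (((-R) ^ k / k.factorial : ℝ) : ℂ)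
  have hf : (fun l : ℕ => ∑ k ∈ Finset.range m, e l * (-(l : ℂ)) ^ k * Complex.exp (-(l * (R : ℂ))) *
      (((-R) ^ k / k.factorial : ℝ) : ℂ)) = fun l : ℕ => (((lam + l) / lam *
        (Real.exp (-(R * l)) * ∑ k ∈ Finset.range m, (R * l) ^ k / k.factorial) * gegenbauer lam l t : ℝ) : ℂ) := by
    funext l
    push_cast
    rw [Finset.mul_sum, Finset.mul_sum, Finset.sum_mul]
    refine Finset.sum_congr rfl fun k _ => ?_
    have : (-(l : ℂ)) ^ k * (-(R : ℂ)) ^ k = (R * l : ℂ) ^ k := by rw [← mul_pow]; ring_nf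
    simp only [e]
    push_cast
    rw [← this, mul_comm (l : ℂ) (R : ℂ)]
    ring
  rw [hf] at hS
  have hS1 := (hasSum_nat_add_iff' 1).2 hS
  have hz : (lam + ((0 : ℕ) : ℝ)) / lam * (Real.exp (-(R * ((0 : ℕ) : ℝ))) *
      ∑ k ∈ Finset.range m, (R * ((0 : ℕ) : ℝ)) ^ k / k.factorial) * gegenbauer lam 0 t = 1 := by
    obtain ⟨p, rfl⟩ : ∃ p, m = p + 1 := ⟨m - 1, by omega⟩
    rw [geg_zero lam h, Finset.sum_range_succ']
    simp [h.ne']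
  rw [Finset.sum_range_one, hz] at hS1
  have hnorm : |∑' l : ℕ, ((lam + (l + 1 : ℕ)) / lam) *
        (Real.exp (-(R * (l + 1 : ℕ))) * ∑ k ∈ Finset.range m, (R * (l + 1 : ℕ)) ^ k / k.factorial) *
        gegenbauer lam (l + 1) t| = ‖T - ((1 : ℝ) : ℂ)‖ := by
    rw [← hS1.tsum_eq, ← Complex.ofReal_tsum, Complex.norm_real, Real.norm_eq_abs]
  rw [hnorm]
  refine (norm_sub_le _ _).trans ?_
  have : ‖((1 : ℝ) : ℂ)‖ = 1 := by simp
  rw [this]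
  gcongr
  refine (norm_sum_le _ _).trans ?_
  rw [Finset.sum_mul]
  refine Finset.sum_le_sum fun k _ => ?_
  have hb := iter_bound (lam + 1) (by positivity) c d t R hR hcd hs hc hd _ rfl hDpos k
  refine le_trans (le_of_eq ?_) hb
  rw [norm_mul, Complex.norm_real, Real.norm_eq_abs, abs_div, abs_pow, abs_neg, abs_of_pos hR, Nat.abs_cast]

/-- the normalized Poisson wavelets with symbol
`γ_m(t) = t^m e^{-t}/Γ(m)` satisfy both linear wavelet admissibility conditions. -/
theorem stmt17 (n m : ℕ) (hn : 2 ≤ n) (hm : 1 ≤ m)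
    (γ : ℝ → ℝ)
    (hγ : ∀ t : ℝ, γ t = t ^ m * Real.exp (-t) / Real.Gamma m) :
    (∀ l : ℕ, 1 ≤ l → ∫ a in Ioi (0 : ℝ), γ (a * l) / a = 1) ∧
    (∃ c : ℝ, ∀ R : ℝ, 0 < R →
      ∫ t in (-1 : ℝ)..1,
        |∑' l : ℕ, ((lamb n + (l + 1 : ℕ)) / lamb n) *
            (∫ a in Ioi R, γ (a * (l + 1 : ℕ)) / a) *
            gegenbauer (lamb n) (l + 1) t| *
          (1 - t ^ 2) ^ (lamb n - 1 / 2) ≤ c) := by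
  have hF (R : ℝ) (hR : 0 ≤ R) (l : ℕ) (hl : 1 ≤ l) : ∫ a in Ioi R, γ (a * l) / a =
      Real.exp (-(R * l)) * ∑ k ∈ Finset.range m, (R * l) ^ k / k.factorial := by
    simp only [hγ]
    exact inc_gamma m hm R hR l (by exact_mod_cast hl)
  have hlam : 1 / 2 ≤ lamb n := by
    have : (2 : ℝ) ≤ n := by exact_mod_cast hn
    unfold lamb
    linarith
  have hlam0 : 0 < lamb n := by linarith
  refine ⟨fun l hl => ?_, ?_⟩
  · rw [hF 0 le_rfl l hl]
    obtain ⟨p, rfl⟩ : ∃ p, m = p + 1 := ⟨m - 1, by omega⟩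
    rw [Finset.sum_range_succ']
    simp
  · set K : ℝ := (∑ k ∈ Finset.range m, (2 : ℝ) ^ k) * (3 * 4 ^ (lamb n + 1))
    have hK : 0 ≤ K := by positivity
    refine ⟨K * 2 + 2, fun R hR => ?_⟩
    have hr0 : 0 < Real.exp (-R) := Real.exp_pos _
    have hr1 : Real.exp (-R) < 1 := by rw [Real.exp_lt_one_iff]; linarith
    set r := Real.exp (-R) with hr
    obtain ⟨hi, hv⟩ := D_int r hr0 hr1
    have hg : IntervalIntegrable (fun t : ℝ => K * ((1 - r ^ 2) *
        (1 - 2 * r * t + r ^ 2) ^ (-(3 / 2) : ℝ)) + 1) volume (-1) 1 :=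
      (hi.const_mul K).add intervalIntegrable_const
    have hgv : ∫ t in (-1 : ℝ)..1, (K * ((1 - r ^ 2) *
        (1 - 2 * r * t + r ^ 2) ^ (-(3 / 2) : ℝ)) + 1) = K * 2 + 2 := by
      rw [intervalIntegral.integral_add (hi.const_mul K) intervalIntegrable_const,
        intervalIntegral.integral_const_mul, hv]
      norm_num
    rw [← hgv, intervalIntegral.integral_of_le (by norm_num), intervalIntegral.integral_of_le (by norm_num)]
    have hg' := (intervalIntegrable_iff_integrableOn_Ioc_of_le (by norm_num)).1 hg
    refine integral_mono_of_nonneg ?_ hg' ?_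
    · filter_upwards [ae_restrict_mem measurableSet_Ioc] with t ht
      have h0 : 0 ≤ 1 - t ^ 2 := by nlinarith [ht.1, ht.2]
      exact mul_nonneg (abs_nonneg _) (Real.rpow_nonneg h0 _)
    · filter_upwards [ae_restrict_mem measurableSet_Ioc] with t ht
      have ht' : t ∈ Icc (-1 : ℝ) 1 := ⟨ht.1.le, ht.2⟩
      have h0 : 0 ≤ 1 - t ^ 2 := by nlinarith [ht.1, ht.2]
      have hw0 : 0 ≤ (1 - t ^ 2) ^ (lamb n - 1 / 2) := Real.rpow_nonneg h0 _
      have hw1 : (1 - t ^ 2) ^ (lamb n - 1 / 2) ≤ 1 :=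
        Real.rpow_le_one h0 (by nlinarith) (by linarith)
      have hb := sum_bound (lamb n) hlam0 m hm t R ht' hR
      have hwt := weight_bound (lamb n) r t hlam hr0 hr1 ht'
      simp only [hF R hR.le (_ + 1) (Nat.le_add_left 1 _)]
      refine (mul_le_mul_of_nonneg_right hb hw0).trans ?_
      rw [← hr]
      have hr2 : 0 ≤ K * (1 - r ^ 2) := mul_nonneg hK (by nlinarith)
      have := mul_le_mul_of_nonneg_left hwt hr2
      calc _ = K * (1 - r ^ 2) * ((1 - 2 * r * t + r ^ 2) ^ (-(lamb n + 1)) *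
              (1 - t ^ 2) ^ (lamb n - 1 / 2)) + (1 - t ^ 2) ^ (lamb n - 1 / 2) := by
            simp only [K]; ring
        _ ≤ _ := by
            rw [← mul_assoc K]
            exact add_le_add this hw1
end

section
/- Let n ≥ 2 be an integer, λ = (n-1)/2, m ∈ ℕ, and for c > 0 and k ∈ ℕ let G_c^k(t) = Σ_{l=0}^∞ ((λ+l)/λ) ψ_k(cl) C_l^λ(t) with ψ_k(t) = (2^k/√Γ(2k)) t^k e^{-t} (the normalized Poisson wavelet of order k at scale c). Then for all a, b > 0 and all x, y on the unit sphere S^n ⊂ ℝ^{n+1}, (1/Σ_n) ∫_{S^n} G_a^m(⟨x,z⟩) G_b^m(⟨z,y⟩) dσ(z) = (√Γ(4m)/Γ(2m)) · (ab)^m/(a+b)^{2m} · G_{a+b}^{2m}(⟨x,y⟩), where dσ is the surface measure on S^n. -/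
open Real MeasureTheory Set Filter
open scoped RealInnerProductSpace BigOperators

set_option linter.unusedSectionVars false
set_option linter.unusedSimpArgs false
set_option linter.unusedVariables false

/-- The normalized Poisson wavelet symbol `ψ_k(t) = (2^k/√Γ(2k)) t^k e^{-t}`. -/
noncomputable def psiK (k : ℕ) (t : ℝ) : ℝ :=
  2 ^ k / Real.sqrt (Real.Gamma (2 * k)) * t ^ k * Real.exp (-t)

/-- The normalized Poisson wavelet `G_c^k` of order `k` at scale `c`. -/
noncomputable def Gw (n k : ℕ) (c t : ℝ) : ℝ :=
  ∑' l : ℕ, ((lamb n + l) / lamb n) * psiK k (c * l) * gegenbauer (lamb n) l t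


namespace GW
open MvPolynomial

section Alg
variable {σ : Type} [Fintype σ] [DecidableEq σ]

noncomputable def lin (w : σ → ℝ) : MvPolynomial σ ℝ := ∑ i, C (w i) * X i
noncomputable def dw (w : σ → ℝ) (Q : MvPolynomial σ ℝ) : MvPolynomial σ ℝ := ∑ i, C (w i) * pderiv i Q
noncomputable def lap (Q : MvPolynomial σ ℝ) : MvPolynomial σ ℝ := ∑ i, pderiv i (pderiv i Q)
noncomputable def rsq : MvPolynomial σ ℝ := ∑ i, X i * X i

lemma pderiv_lin (w : σ → ℝ) (i : σ) : pderiv i (lin w) = C (w i) := by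
  unfold lin
  rw [map_sum, Finset.sum_eq_single i]
  · simp
  · intro j _ hj
    simp [pderiv_C_mul, pderiv_X_of_ne hj]
  · simp

lemma pderiv_rsq (i : σ) : pderiv i (rsq : MvPolynomial σ ℝ) = 2 * X i := by
  unfold rsq
  rw [map_sum, Finset.sum_eq_single i]
  · rw [pderiv_mul]; simp; ring
  · intro j _ hj
    rw [pderiv_mul]; simp [pderiv_X_of_ne hj]
  · simp

lemma pderiv_comm' (i j : σ) (Q : MvPolynomial σ ℝ) :
    pderiv i (pderiv j Q) = pderiv j (pderiv i Q) := by
  ext m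
  simp only [coeff_pderiv]
  by_cases h : i = j
  · subst h; ring
  · have h1 : (m + Finsupp.single i 1 : σ →₀ ℕ) j = m j := by simp [h]
    have h2 : (m + Finsupp.single j 1 : σ →₀ ℕ) i = m i := by simp [Ne.symm h]
    rw [h1, h2, add_right_comm]; ring

lemma lap_dw (w : σ → ℝ) (Q : MvPolynomial σ ℝ) (h : lap Q = 0) : lap (dw w Q) = 0 := by
  have : lap (dw w Q) = dw w (lap Q) := by
    unfold lap dw
    simp only [map_sum, pderiv_C_mul, Finset.mul_sum]
    rw [Finset.sum_comm]
    refine Finset.sum_congr rfl fun i _ => Finset.sum_congr rfl fun j _ => ?_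
    rw [pderiv_comm' j i, pderiv_comm' j i]
  rw [this, h]; simp [dw]

lemma dw_hom (w : σ → ℝ) (Q : MvPolynomial σ ℝ) (d : ℕ) (h : Q.IsHomogeneous (d + 1)) :
    (dw w Q).IsHomogeneous d := by
  unfold dw
  refine IsHomogeneous.sum _ _ _ fun i _ => ?_
  have := (isHomogeneous_C σ (w i)).mul (h.pderiv (i := i))
  simpa using this

lemma lin_hom (w : σ → ℝ) : (lin w).IsHomogeneous 1 := by
  unfold lin
  refine IsHomogeneous.sum _ _ _ fun i _ => ?_
  simpa using (isHomogeneous_C σ (w i)).mul (isHomogeneous_X ℝ i)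

lemma rsq_hom : (rsq : MvPolynomial σ ℝ).IsHomogeneous 2 := by
  unfold rsq
  refine IsHomogeneous.sum _ _ _ fun i _ => ?_
  simpa using (isHomogeneous_X ℝ i).mul (isHomogeneous_X ℝ i)

lemma eval_dw (w : σ → ℝ) (Q : MvPolynomial σ ℝ) (d : ℕ) (h : Q.IsHomogeneous d) :
    eval w (dw w Q) = d * eval w Q := by
  have := congrArg (eval w) h.sum_X_mul_pderiv
  simpa [dw] using this

lemma dw_mul (w : σ → ℝ) (P Q : MvPolynomial σ ℝ) : dw w (P * Q) = dw w P * Q + P * dw w Q := by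
  unfold dw
  rw [Finset.sum_mul, Finset.mul_sum, ← Finset.sum_add_distrib]
  refine Finset.sum_congr rfl fun i _ => ?_
  rw [pderiv_mul]; ring

lemma dw_lin_pow (w : σ → ℝ) (p : ℕ) :
    dw w (lin w ^ (p + 1)) = C ((p + 1 : ℝ) * ∑ i, w i * w i) * lin w ^ p := by
  unfold dw
  simp only [pderiv_pow, pderiv_lin, C_mul, map_sum, Finset.mul_sum, Finset.sum_mul]
  refine Finset.sum_congr rfl fun i _ => ?_
  simp
  ring


lemma E_lin (E : MvPolynomial σ ℝ →ₗ[ℝ] ℝ) (hE : ∀ i Q, E (X i * Q) = E (pderiv i Q))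
    (w : σ → ℝ) (Q : MvPolynomial σ ℝ) : E (lin w * Q) = E (dw w Q) := by
  unfold lin dw
  simp only [Finset.sum_mul, map_sum, mul_assoc, C_mul', smul_mul_assoc, map_smul, hE]

lemma E_harm (E : MvPolynomial σ ℝ →ₗ[ℝ] ℝ) (hE : ∀ i Q, E (X i * Q) = E (pderiv i Q))
    (d : ℕ) (P : MvPolynomial σ ℝ) (hP : P.IsHomogeneous (d + 1)) (hl : lap P = 0) :
    E P = 0 := by
  have h1 := congrArg E hP.sum_X_mul_pderiv
  rw [map_sum] at h1
  simp only [hE] at h1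
  rw [← map_sum] at h1
  change E (lap P) = _ at h1
  rw [hl, map_zero, map_nsmul, nsmul_eq_mul] at h1
  have : ((d + 1 : ℕ) : ℝ) ≠ 0 := by positivity
  rcases mul_eq_zero.1 h1.symm with h | h
  · exact absurd h this
  · exact h

lemma E_lt (E : MvPolynomial σ ℝ →ₗ[ℝ] ℝ) (hE : ∀ i Q, E (X i * Q) = E (pderiv i Q))
    (w : σ → ℝ) (p : ℕ) : ∀ (d : ℕ) (P : MvPolynomial σ ℝ), P.IsHomogeneous d → lap P = 0 →
    p < d → E (P * lin w ^ p) = 0 := by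
  induction p using Nat.strong_induction_on with
  | _ p ih =>
  intro d P hP hl hpd
  obtain ⟨d, rfl⟩ : ∃ e, d = e + 1 := ⟨d - 1, by omega⟩
  rcases p with _ | p
  · simpa using E_harm E hE d P hP hl
  · have e1 : P * lin w ^ (p + 1) = lin w * (P * lin w ^ p) := by ring
    rw [e1, E_lin E hE, dw_mul, map_add, ih p (by omega) d _ (dw_hom w P d hP) (lap_dw w P hl) (by omega)]
    rcases p with _ | p
    · simp [dw]
    · rw [dw_lin_pow, mul_left_comm, C_mul', map_smul, ih p (by omega) _ P hP hl (by omega)]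
      simp

lemma E_eq (E : MvPolynomial σ ℝ →ₗ[ℝ] ℝ) (hE : ∀ i Q, E (X i * Q) = E (pderiv i Q))
    (w : σ → ℝ) (d : ℕ) : ∀ (P : MvPolynomial σ ℝ), P.IsHomogeneous d → lap P = 0 →
    E (P * lin w ^ d) = d.factorial * eval w P * E 1 := by
  induction d with
  | zero =>
    intro P hP _
    obtain ⟨c, rfl⟩ : ∃ c, P = C c := ⟨_, totalDegree_eq_zero_iff_eq_C.1 (Nat.le_zero.1 hP.totalDegree_le)⟩
    rw [pow_zero, C_mul', map_smul]
    simp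
  | succ d ih =>
    intro P hP hl
    have e1 : P * lin w ^ (d + 1) = lin w * (P * lin w ^ d) := by ring
    rw [e1, E_lin E hE, dw_mul, map_add, ih _ (dw_hom w P d hP) (lap_dw w P hl), eval_dw w P _ hP]
    have : E (P * dw w (lin w ^ d)) = 0 := by
      rcases d with _ | p
      · simp [dw]
      · rw [dw_lin_pow, mul_left_comm, C_mul', map_smul, E_lt E hE w p _ P hP hl (by omega)]
        simp
    rw [this, Nat.factorial_succ]; push_cast; ring
end Alg

section Zon
variable {σ : Type} [Fintype σ] [DecidableEq σ]

lemma lap_term (y : σ → ℝ) (hy : ∑ i, y i * y i = 1) (a k : ℕ) :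
    lap (lin y ^ a * rsq ^ k) = C ((a : ℝ) * (a - 1)) * lin y ^ (a - 2) * rsq ^ k
      + C (4 * (a : ℝ) * k + 2 * k * (2 * k - 2 + Fintype.card σ)) * lin y ^ a * rsq ^ (k - 1) := by
  have h1 : ∀ i, pderiv i (pderiv i (lin y ^ a * rsq ^ k)) =
      ((a : MvPolynomial σ ℝ) * ((a - 1 : ℕ) : MvPolynomial σ ℝ) * lin y ^ (a - 1 - 1) * rsq ^ k) * C (y i * y i)
      + (4 * (a : MvPolynomial σ ℝ) * (k : MvPolynomial σ ℝ) * lin y ^ (a - 1) * rsq ^ (k - 1)) * (C (y i) * X i)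
      + (4 * (k : MvPolynomial σ ℝ) * ((k - 1 : ℕ) : MvPolynomial σ ℝ) * lin y ^ a * rsq ^ (k - 1 - 1)) * (X i * X i)
      + (2 * (k : MvPolynomial σ ℝ) * lin y ^ a * rsq ^ (k - 1)) * 1 := by
    intro i
    simp only [pderiv_mul, pderiv_pow, pderiv_lin, pderiv_rsq, map_add, pderiv_C, pderiv_X_self,
      map_natCast, Derivation.map_natCast]
    have h2 : pderiv i (2 : MvPolynomial σ ℝ) = 0 := by
      exact (pderiv i).map_natCast 2
    rw [h2]
    simp only [C_mul]
    ring
  unfold lap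
  simp only [h1, Finset.sum_add_distrib, ← Finset.mul_sum]
  rw [← map_sum, hy, show ∑ i, C (y i) * X i = lin y from rfl, show ∑ i, X i * X i = (rsq : MvPolynomial σ ℝ) from rfl]
  simp only [Finset.sum_const, Finset.card_univ, nsmul_eq_mul, mul_one, C_1]
  have hC2 : (C 2 : MvPolynomial σ ℝ) = 2 := map_ofNat C 2
  have hC4 : (C 4 : MvPolynomial σ ℝ) = 4 := map_ofNat C 4
  rcases a with _ | _ | a <;> rcases k with _ | _ | k <;> simp [pow_succ, hC2, hC4] <;> ring

noncomputable def gc (lam : ℝ) (l k : ℕ) : ℝ := (-1 : ℝ) ^ k * Real.Gamma ((l : ℝ) - (k : ℝ) + lam) /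
      (Real.Gamma lam * (Nat.factorial k : ℝ) * (Nat.factorial (l - 2 * k) : ℝ))

lemma geg_eq (lam : ℝ) (l : ℕ) (t : ℝ) : gegenbauer lam l t =
  ∑ k ∈ Finset.range (l / 2 + 1), gc lam l k * (2 * t) ^ (l - 2 * k) := rfl

lemma gc_rel (lam : ℝ) (hlam : 0 < lam) (r k : ℕ) :
    gc lam (r + 2 * (k + 1)) (k + 1) * ((k + 1) * ((r : ℝ) + k + 1 + lam)) =
      - gc lam (r + 2 * (k + 1)) k * ((r + 2) * (r + 1)) := by
  unfold gc
  have e1 : ((r + 2 * (k + 1) : ℕ) : ℝ) - ((k + 1 : ℕ) : ℝ) + lam = (r : ℝ) + k + 1 + lam := by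
    push_cast; ring
  have e2 : ((r + 2 * (k + 1) : ℕ) : ℝ) - (k : ℝ) + lam = ((r : ℝ) + k + 1 + lam) + 1 := by
    push_cast; ring
  have hp : (r : ℝ) + k + 1 + lam ≠ 0 := by positivity
  rw [e1, e2, Real.Gamma_add_one hp, show r + 2 * (k + 1) - 2 * (k + 1) = r by omega,
    show r + 2 * (k + 1) - 2 * k = r + 2 by omega]
  simp only [Nat.factorial_succ]
  have := (Real.Gamma_pos_of_pos hlam).ne'
  push_cast
  field_simp
  ring

noncomputable def zon (lam : ℝ) (l : ℕ) (y : σ → ℝ) : MvPolynomial σ ℝ :=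
  ∑ k ∈ Finset.range (l / 2 + 1), C (gc lam l k * 2 ^ (l - 2 * k)) * (lin y ^ (l - 2 * k) * rsq ^ k)

lemma zon_hom (lam : ℝ) (l : ℕ) (y : σ → ℝ) : (zon lam l y).IsHomogeneous l := by
  unfold zon
  refine IsHomogeneous.sum _ _ _ fun k hk => ?_
  have hk := Finset.mem_range.1 hk
  have := (isHomogeneous_C σ (gc lam l k * 2 ^ (l - 2 * k))).mul
    (((lin_hom y).pow (l - 2 * k)).mul ((rsq_hom (σ := σ)).pow k))
  convert this using 1
  omega

lemma lap_sum_smul (s : Finset ℕ) (c : ℕ → ℝ) (f : ℕ → MvPolynomial σ ℝ) :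
    lap (∑ k ∈ s, C (c k) * f k) = ∑ k ∈ s, C (c k) * lap (f k) := by
  unfold lap
  simp only [map_sum, pderiv_C_mul, Finset.mul_sum]
  rw [Finset.sum_comm]

lemma zon_harm (lam : ℝ) (hlam : 0 < lam) (hc : (Fintype.card σ : ℝ) = 2 * lam + 2) (l : ℕ) (y : σ → ℝ)
    (hy : ∑ i, y i * y i = 1) : lap (zon lam l y) = 0 := by
  unfold zon
  rw [lap_sum_smul]
  simp only [lap_term y hy]
  simp only [mul_add (C (gc _ _ _ * _)), Finset.sum_add_distrib]
  rw [Finset.sum_range_succ, Finset.sum_range_succ' (fun k => C (gc lam l k * 2 ^ (l - 2 * k)) *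
    (C (4 * ((l - 2 * k : ℕ) : ℝ) * k + 2 * k * (2 * k - 2 + Fintype.card σ)) * lin y ^ (l - 2 * k) * rsq ^ (k - 1)))]
  have h0 : (((l - 2 * (l / 2) : ℕ) : ℝ) * (((l - 2 * (l / 2) : ℕ) : ℝ) - 1)) = 0 := by
    rcases Nat.even_or_odd l with ⟨j, hj⟩ | ⟨j, hj⟩
    · rw [show l - 2 * (l / 2) = 0 by omega]; simp
    · rw [show l - 2 * (l / 2) = 1 by omega]; simp
  rw [h0]
  have h1 : ∀ k ∈ Finset.range (l / 2), C (gc lam l k * 2 ^ (l - 2 * k)) *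
      (C (((l - 2 * k : ℕ) : ℝ) * (((l - 2 * k : ℕ) : ℝ) - 1)) * lin y ^ (l - 2 * k - 2) * rsq ^ k)
      = - (C (gc lam l (k + 1) * 2 ^ (l - 2 * (k + 1))) *
    (C (4 * ((l - 2 * (k + 1) : ℕ) : ℝ) * ((k + 1 : ℕ) : ℝ) + 2 * ((k + 1 : ℕ) : ℝ) * (2 * ((k + 1 : ℕ) : ℝ) - 2 + Fintype.card σ))
      * lin y ^ (l - 2 * (k + 1)) * rsq ^ (k + 1 - 1))) := by
    intro k hk
    have hk := Finset.mem_range.1 hk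
    obtain ⟨r, rfl⟩ : ∃ r, l = r + 2 * (k + 1) := ⟨l - 2 * (k + 1), by omega⟩
    have hr := gc_rel lam hlam r k
    rw [show r + 2 * (k + 1) - 2 * (k + 1) = r by omega,
      show r + 2 * (k + 1) - 2 * k = r + 2 by omega, hc]
    simp only [Nat.add_sub_cancel, ← mul_assoc, ← C_mul, ← neg_mul, ← C_neg]
    congr 3
    push_cast
    linear_combination (4 * 2 ^ r) * hr
  rw [Finset.sum_congr rfl h1, Finset.sum_neg_distrib]
  simp
end Zon

section One

noncomputable def gt (lam : ℝ) (l k : ℕ) : ℝ := if 2 * k ≤ l then gc lam l k * 2 ^ (l - 2 * k) else 0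

lemma geg_one (lam : ℝ) (l M : ℕ) (hM : l / 2 + 1 ≤ M) :
    gegenbauer lam l 1 = ∑ k ∈ Finset.range M, gt lam l k := by
  rw [geg_eq, ← Finset.sum_subset (Finset.range_mono hM) (f := gt lam l)]
  · refine Finset.sum_congr rfl fun k hk => ?_
    have hk := Finset.mem_range.1 hk
    rw [gt, if_pos (by omega), mul_one]
  · intro k _ hk
    rw [gt, if_neg]
    have : ¬ k < l / 2 + 1 := by simpa using hk
    omega

lemma gt_zero (lam : ℝ) (hlam : 0 < lam) (l : ℕ) :
    (l + 2 : ℝ) * gt lam (l + 2) 0 = 2 * (l + 1 + lam) * gt lam (l + 1) 0 := by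
  simp only [gt, gc]
  have e2 : ((l + 2 : ℕ) : ℝ) - ((0 : ℕ) : ℝ) + lam = ((l : ℝ) + 1 + lam) + 1 := by push_cast; ring
  have e1 : ((l + 1 : ℕ) : ℝ) - ((0 : ℕ) : ℝ) + lam = ((l : ℝ) + 1 + lam) := by push_cast; ring
  have hp : (l : ℝ) + 1 + lam ≠ 0 := by positivity
  rw [e1, e2, Real.Gamma_add_one hp]
  have := (Real.Gamma_pos_of_pos hlam).ne'
  simp [Nat.factorial_succ]
  field_simp
  ring

lemma gt_succ (lam : ℝ) (hlam : 0 < lam) (l k : ℕ) :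
    (l + 2 : ℝ) * gt lam (l + 2) (k + 1) = 2 * (l + 1 + lam) * gt lam (l + 1) (k + 1)
      - (l + 2 * lam) * gt lam l k := by
  have hG := (Real.Gamma_pos_of_pos hlam).ne'
  by_cases h : 2 * k ≤ l
  · obtain ⟨r, rfl⟩ := Nat.exists_eq_add_of_le h
    have hp : (k : ℝ) + r + lam ≠ 0 := by positivity
    have e2 : ((2 * k + r + 2 : ℕ) : ℝ) - ((k + 1 : ℕ) : ℝ) + lam = ((k : ℝ) + r + lam) + 1 := by push_cast; ring
    have e1 : ((2 * k + r + 1 : ℕ) : ℝ) - ((k + 1 : ℕ) : ℝ) + lam = ((k : ℝ) + r + lam) := by push_cast; ring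
    have e0 : ((2 * k + r : ℕ) : ℝ) - (k : ℝ) + lam = ((k : ℝ) + r + lam) := by push_cast; ring
    rcases r with _ | r
    · simp only [gt, gc]
      rw [if_pos (by omega), if_neg (by omega), if_pos (by omega), e2, e0, Real.Gamma_add_one hp]
      rw [show 2 * k + 0 + 2 - 2 * (k + 1) = 0 by omega, show 2 * k + 0 - 2 * k = 0 by omega]
      simp [Nat.factorial_succ]
      field_simp
      ring
    · simp only [gt, gc]
      rw [if_pos (by omega), if_pos (by omega), if_pos (by omega), e2, e0, e1, Real.Gamma_add_one hp]
      rw [show 2 * k + (r + 1) + 2 - 2 * (k + 1) = r + 1 by omega, show 2 * k + (r + 1) - 2 * k = r + 1 by omega,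
        show 2 * k + (r + 1) + 1 - 2 * (k + 1) = r by omega]
      simp [Nat.factorial_succ]
      field_simp
      ring
  · simp only [gt]
    rw [if_neg (by omega), if_neg (by omega), if_neg (by omega)]; simp

lemma geg_rec (lam : ℝ) (hlam : 0 < lam) (l : ℕ) :
    (l + 2 : ℝ) * gegenbauer lam (l + 2) 1 = 2 * (l + 1 + lam) * gegenbauer lam (l + 1) 1
      - (l + 2 * lam) * gegenbauer lam l 1 := by
  rw [geg_one lam (l + 2) (l + 3) (by omega), geg_one lam (l + 1) (l + 3) (by omega),
    geg_one lam l (l + 2) (by omega), Finset.sum_range_succ' (gt lam (l + 2)),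
    Finset.sum_range_succ' (gt lam (l + 1)), mul_add, mul_add,
    gt_zero lam hlam, Finset.mul_sum, Finset.sum_congr rfl fun k _ => gt_succ lam hlam l k,
    Finset.sum_sub_distrib, ← Finset.mul_sum, ← Finset.mul_sum]
  ring

lemma geg_ratio (lam : ℝ) (hlam : 0 < lam) (l : ℕ) :
    (l + 1 : ℝ) * gegenbauer lam (l + 1) 1 = (l + 2 * lam) * gegenbauer lam l 1 := by
  have hG := (Real.Gamma_pos_of_pos hlam).ne'
  induction l with
  | zero =>
    simp [gegenbauer]
    rw [add_comm, Real.Gamma_add_one hlam.ne']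
    field_simp
  | succ l ih =>
    have := geg_rec lam hlam l
    push_cast
    linear_combination this + ih

/-- polynomial bound of the value at `1` -/
lemma geg_bound (q : ℕ) (lam : ℝ) (hlam : 0 < lam) (hq : 2 * lam ≤ q + 1) (l : ℕ) :
    0 ≤ gegenbauer lam l 1 ∧ gegenbauer lam l 1 ≤ (l + 1 : ℝ) ^ q := by
  have hG := (Real.Gamma_pos_of_pos hlam).ne'
  induction l with
  | zero => simp [gegenbauer, hG]
  | succ l ih =>
    have h := geg_ratio lam hlam l
    have hl : (0 : ℝ) < l + 1 := by positivity
    have e : gegenbauer lam (l + 1) 1 = (l + 2 * lam) / (l + 1) * gegenbauer lam l 1 := by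
      field_simp; linarith
    rw [e]
    constructor
    · have := ih.1; positivity
    · calc (l + 2 * lam) / (l + 1) * gegenbauer lam l 1 ≤ (1 + 1 / (l + 1 : ℝ)) ^ q * (l + 1 : ℝ) ^ q := by
            have h1 := one_add_mul_le_pow (a := 1 / (l + 1 : ℝ)) (by have : 0 ≤ 1 / (l + 1 : ℝ) := by positivity
                                                                     linarith) q
            have h2 : (l + 2 * lam) / (l + 1) ≤ 1 + q * (1 / (l + 1 : ℝ)) := by
              rw [div_le_iff₀ hl]; field_simp; linarith
            exact mul_le_mul (h2.trans h1) ih.2 ih.1 (by positivity)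
        _ = _ := by rw [← mul_pow]; congr 1; push_cast; field_simp
end One

section Gauss
variable {σ : Type} [Fintype σ] [DecidableEq σ]

noncomputable def mom (k : ℕ) : ℝ := ∫ x : ℝ, x ^ k * Real.exp (-(1 / 2) * x ^ 2)

lemma mom_int (k : ℕ) : Integrable (fun x : ℝ => x ^ k * Real.exp (-(1 / 2) * x ^ 2)) := by
  have := integrable_rpow_mul_exp_neg_mul_sq (b := 1 / 2) (by norm_num) (s := (k : ℝ))
    (by have : (0 : ℝ) ≤ k := by positivity
        linarith)
  simpa [Real.rpow_natCast] using this

lemma mom_succ (k : ℕ) : mom (k + 1) = k * mom (k - 1) := by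
  have hv : ∀ x : ℝ, HasDerivAt (fun x : ℝ => Real.exp (-(1 / 2) * x ^ 2))
      (-x * Real.exp (-(1 / 2) * x ^ 2)) x := by
    intro x
    have := (((hasDerivAt_pow 2 x).const_mul (-(1 / 2) : ℝ))).exp
    convert this using 1
    simp; ring
  have h := integral_mul_deriv_eq_deriv_mul_of_integrable
    (u := fun x : ℝ => x ^ k) (u' := fun x : ℝ => k * x ^ (k - 1))
    (v := fun x : ℝ => Real.exp (-(1 / 2) * x ^ 2))
    (v' := fun x : ℝ => -x * Real.exp (-(1 / 2) * x ^ 2))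
    (fun x _ => hasDerivAt_pow k x) (fun x _ => hv x)
    (by convert (mom_int (k + 1)).neg using 1; ext x; simp; ring)
    (by convert (mom_int (k - 1)).const_mul (k : ℝ) using 1; ext x; simp; ring)
    (mom_int k)
  unfold mom
  rw [← integral_const_mul, ← neg_inj]
  have e2 : ∫ x : ℝ, (k : ℝ) * (x ^ (k - 1) * Real.exp (-(1 / 2) * x ^ 2)) =
      ∫ x : ℝ, k * x ^ (k - 1) * Real.exp (-(1 / 2) * x ^ 2) := by
    congr 1; ext x; ring
  rw [e2, ← h, ← integral_neg]
  congr 1; ext x; ring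

lemma eval_mono (s : σ →₀ ℕ) (c : ℝ) (z : σ → ℝ) :
    eval z (monomial s c) * Real.exp (-(1 / 2) * ∑ i, z i ^ 2)
      = c * ∏ i, (z i ^ s i * Real.exp (-(1 / 2) * z i ^ 2)) := by
  rw [eval_monomial, Finset.prod_mul_distrib, ← Real.exp_sum, Finset.mul_sum,
    Finsupp.prod_fintype _ _ (by simp)]
  ring

lemma gauss_int (P : MvPolynomial σ ℝ) :
    Integrable (fun z : σ → ℝ => eval z P * Real.exp (-(1 / 2) * ∑ i, z i ^ 2)) := by
  induction P using MvPolynomial.induction_on' with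
  | monomial s c =>
    simp only [eval_mono]
    exact (Integrable.fintype_prod (f := fun i (x : ℝ) => x ^ s i * Real.exp (-(1 / 2) * x ^ 2))
      (fun i => mom_int (s i))).const_mul c
  | add p q hp hq =>
    simp only [map_add, add_mul]
    exact hp.add hq

noncomputable def gE : MvPolynomial σ ℝ →ₗ[ℝ] ℝ where
  toFun P := ∫ z : σ → ℝ, eval z P * Real.exp (-(1 / 2) * ∑ i, z i ^ 2)
  map_add' p q := by
    simp only [map_add, add_mul]
    exact integral_add (gauss_int p) (gauss_int q)
  map_smul' c p := by
    simp only [smul_eval, mul_assoc, RingHom.id_apply, smul_eq_mul]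
    rw [integral_const_mul]

lemma gE_apply (P : MvPolynomial σ ℝ) :
  gE P = ∫ z : σ → ℝ, eval z P * Real.exp (-(1 / 2) * ∑ i, z i ^ 2) := rfl

lemma gE_mono (s : σ →₀ ℕ) (c : ℝ) : gE (monomial s c) = c * ∏ i, mom (s i) := by
  rw [gE_apply]
  simp only [eval_mono]
  rw [integral_const_mul,
    integral_fintype_prod_volume_eq_prod (fun i (x : ℝ) => x ^ s i * Real.exp (-(1 / 2) * x ^ 2))]
  rfl

lemma gE_stein (i : σ) (Q : MvPolynomial σ ℝ) : gE (X i * Q) = gE (pderiv i Q) := by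
  induction Q using MvPolynomial.induction_on' with
  | add p q hp hq => rw [mul_add, map_add, map_add, map_add, hp, hq]
  | monomial s c =>
    rw [pderiv_monomial, show (X i : MvPolynomial σ ℝ) = monomial (Finsupp.single i 1) 1 from rfl,
      monomial_mul, gE_mono, gE_mono, ← Finset.mul_prod_erase _ _ (Finset.mem_univ i),
      ← Finset.mul_prod_erase _ (fun j => mom ((s - Finsupp.single i 1 : σ →₀ ℕ) j)) (Finset.mem_univ i)]
    have h : ∀ j ∈ Finset.univ.erase i, mom ((Finsupp.single i 1 + s : σ →₀ ℕ) j) = mom ((s - Finsupp.single i 1 : σ →₀ ℕ) j) := by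
      intro j hj
      have hj : j ≠ i := Finset.ne_of_mem_erase hj
      simp [Finsupp.single_apply, hj.symm]
    rw [Finset.prod_congr rfl h]
    have h2 : (Finsupp.single i 1 + s : σ →₀ ℕ) i = s i + 1 := by simp [add_comm]
    have h3 : (s - Finsupp.single i 1 : σ →₀ ℕ) i = s i - 1 := by simp
    rw [h2, h3, mom_succ]
    ring
end Gauss

section Sph
variable (n : ℕ)
local notation "EE" => EuclideanSpace ℝ (Fin (n + 1))

noncomputable def Kc (n d : ℕ) : ℝ := ∫ r in Ioi (0 : ℝ), r ^ n * (r ^ d * Real.exp (-(1 / 2) * r ^ 2))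

lemma eval_smul_hom {σ : Type} (P : MvPolynomial σ ℝ) (d : ℕ) (hP : P.IsHomogeneous d) (r : ℝ) (z : σ → ℝ) :
    eval (fun i => r * z i) P = r ^ d * eval z P := by
  rw [eval_eq, eval_eq, Finset.mul_sum]
  refine Finset.sum_congr rfl fun s hs => ?_
  have : ∑ i ∈ s.support, s i = d := by
    have := hP (mem_support_iff.1 hs)
    rw [Finsupp.weight_apply] at this
    simpa [Finsupp.sum] using this
  simp only [mul_pow]
  rw [Finset.prod_mul_distrib, Finset.prod_pow_eq_pow_sum, this]
  ring

lemma polar (P : MvPolynomial (Fin (n + 1)) ℝ) (d : ℕ) (hP : P.IsHomogeneous d) :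
    gE P = Kc n d * ∫ w : Metric.sphere (0 : EE) 1, eval (fun i => (w : EE) i) P
      ∂((volume : Measure EE).toSphere) := by
  have h1 : gE P = ∫ z : EE, eval (fun i => z i) P * Real.exp (-(1 / 2) * ‖z‖ ^ 2) := by
    rw [gE_apply, ← (PiLp.volume_preserving_ofLp (Fin (n + 1))).integral_comp
      (MeasurableEquiv.toLp 2 (Fin (n + 1) → ℝ)).symm.measurableEmbedding]
    congr 1; ext z
    rw [EuclideanSpace.real_norm_sq_eq]
  have hdim : Module.finrank ℝ EE - 1 = n := by simp
  rw [h1]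
  calc _ = ∫ x : ({(0)}ᶜ : Set EE), eval (fun i => (x : EE) i) P * Real.exp (-(1 / 2) * ‖(x : EE)‖ ^ 2)
          ∂((volume : Measure EE).comap (↑)) := by
        rw [integral_subtype_comap (isClosed_singleton.measurableSet : MeasurableSet ({0} : Set EE)).compl
          fun x : EE ↦ eval (fun i => x i) P * Real.exp (-(1 / 2) * ‖x‖ ^ 2),
          restrict_compl_singleton]
    _ = ∫ x, eval (fun i => (x.1 : EE) i) P * ((x.2 : ℝ) ^ d * Real.exp (-(1 / 2) * (x.2 : ℝ) ^ 2))
          ∂(volume : Measure EE).toSphere.prod (.volumeIoiPow (Module.finrank ℝ EE - 1)) := by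
        rw [← ((volume : Measure EE).measurePreserving_homeomorphUnitSphereProd).integral_comp
          (Homeomorph.measurableEmbedding _)]
        refine integral_congr_ae (Eventually.of_forall fun x => ?_)
        simp only [homeomorphUnitSphereProd_apply_snd_coe, homeomorphUnitSphereProd_apply_fst_coe]
        have hx : ‖(x : EE)‖ ≠ 0 := norm_ne_zero_iff.2 x.2
        have := eval_smul_hom P d hP ‖(x : EE)‖ (fun i => (‖(x : EE)‖⁻¹ • (x : EE)) i)
        have e : (fun i => ‖(x : EE)‖ * (‖(x : EE)‖⁻¹ • (x : EE)) i) = fun i => (x : EE) i := by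
          ext i; simp [hx]
        rw [e] at this
        rw [this]; ring
    _ = _ := by
        rw [integral_prod_mul (fun w : Metric.sphere (0 : EE) 1 => eval (fun i => (w : EE) i) P)
          (fun r : Ioi (0 : ℝ) => ((r : ℝ) ^ d * Real.exp (-(1 / 2) * (r : ℝ) ^ 2))), mul_comm, hdim]
        congr 1
        unfold Kc
        simp only [Measure.volumeIoiPow, ENNReal.ofReal]
        rw [integral_withDensity_eq_integral_smul,
          integral_subtype_comap measurableSet_Ioi fun a : ℝ ↦ Real.toNNReal (a ^ n) • (a ^ d * Real.exp (-(1 / 2) * a ^ 2)),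
          setIntegral_congr_fun measurableSet_Ioi fun x hx ↦ ?_]
        · rw [NNReal.smul_def, Real.coe_toNNReal _ (pow_nonneg hx.out.le _), smul_eq_mul]
        · exact (measurable_subtype_coe.pow_const _).real_toNNReal

lemma Kc_eq (d : ℕ) : Kc n (2 * d) = 2 ^ d * (2 : ℝ) ^ (lamb n) * Real.Gamma (lamb n + 1 + d) := by
  have h := integral_rpow_mul_exp_neg_mul_rpow (p := 2) (q := (n : ℝ) + 2 * d) (b := 1 / 2) (by norm_num)
    (by have : (0 : ℝ) ≤ (n : ℝ) + 2 * d := by positivity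
        linarith) (by norm_num)
  have e : Kc n (2 * d) = ∫ x in Ioi (0 : ℝ), x ^ ((n : ℝ) + 2 * d) * Real.exp (-(1 / 2) * x ^ (2 : ℝ)) := by
    unfold Kc
    refine setIntegral_congr_fun measurableSet_Ioi fun x hx => ?_
    have e1 : (n : ℝ) + 2 * d = ((n + 2 * d : ℕ) : ℝ) := by push_cast; ring
    have e2 : x ^ (2 : ℝ) = x ^ 2 := by exact_mod_cast Real.rpow_natCast x 2
    simp only [e1, Real.rpow_natCast, e2]
    ring
  rw [e, h]
  have e3 : (((n : ℝ) + 2 * d + 1) / 2) = lamb n + 1 + d := by unfold lamb; ring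
  have e4 : (-((n : ℝ) + 2 * d + 1) / 2) = -(lamb n + 1 + d) := by unfold lamb; ring
  rw [e3, e4, one_div, Real.inv_rpow (by norm_num), Real.rpow_neg (by norm_num), inv_inv,
    Real.rpow_add (by norm_num), Real.rpow_add (by norm_num), Real.rpow_one, Real.rpow_natCast]
  ring

lemma sphere_total : ((volume : Measure EE).toSphere).real univ = sigmaN n := by
  rw [Measure.toSphere_real_apply_univ, measureReal_def, EuclideanSpace.volume_ball]
  have hp : (0 : ℝ) < ((n : ℝ) + 1) / 2 := by positivity
  have hl : lamb n + 1 = ((n : ℝ) + 1) / 2 := by unfold lamb; ring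
  unfold sigmaN
  rw [hl]
  simp only [finrank_euclideanSpace, Fintype.card_fin, ENNReal.ofReal_one, one_pow, one_mul]
  rw [ENNReal.toReal_ofReal (by push_cast; positivity)]
  push_cast
  rw [Real.Gamma_add_one hp.ne', Real.sqrt_eq_rpow, ← Real.rpow_natCast, ← Real.rpow_mul Real.pi_pos.le]
  have := (Real.Gamma_pos_of_pos hp).ne'
  rw [show (1 / 2 : ℝ) * ((n + 1 : ℕ) : ℝ) = ((n : ℝ) + 1) / 2 by push_cast; ring]
  field_simp
end Sph

section Conv
variable (n : ℕ)
local notation "EE" => EuclideanSpace ℝ (Fin (n + 1))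
local notation "SS" => Metric.sphere (0 : EuclideanSpace ℝ (Fin (n + 1))) 1
local notation "μS" => (Measure.toSphere (volume : Measure (EuclideanSpace ℝ (Fin (n + 1)))))

lemma Kc_pos (d : ℕ) : 0 < Kc n d := by
  have h := integral_rpow_mul_exp_neg_mul_rpow (p := 2) (q := (n : ℝ) + d) (b := 1 / 2) (by norm_num)
    (by have : (0 : ℝ) ≤ (n : ℝ) + d := by positivity
        linarith) (by norm_num)
  have e : Kc n d = ∫ x in Ioi (0 : ℝ), x ^ ((n : ℝ) + d) * Real.exp (-(1 / 2) * x ^ (2 : ℝ)) := by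
    unfold Kc
    refine setIntegral_congr_fun measurableSet_Ioi fun x hx => ?_
    have e1 : (n : ℝ) + d = ((n + d : ℕ) : ℝ) := by push_cast; ring
    have e2 : x ^ (2 : ℝ) = x ^ 2 := by exact_mod_cast Real.rpow_natCast x 2
    simp only [e1, Real.rpow_natCast, e2]
    ring
  rw [e, h]
  have := Real.Gamma_pos_of_pos (s := ((n : ℝ) + d + 1) / 2) (by positivity)
  positivity

lemma inner_eq (x y : EE) : ⟪x, y⟫ = ∑ i, x i * y i := by
  rw [PiLp.inner_apply]
  refine Finset.sum_congr rfl fun i _ => ?_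
  simp [mul_comm]

lemma sum_sq (x : SS) : ∑ i, (x : EE) i * (x : EE) i = 1 := by
  rw [← inner_eq, real_inner_self_eq_norm_sq]
  simp

lemma eval_lin (w z : EE) : eval (fun i => z i) (lin (fun i => w i)) = ⟪w, z⟫ := by
  rw [inner_eq]; simp [lin]

lemma eval_zon (l : ℕ) (y z : SS) : eval (fun i => (z : EE) i) (zon (lamb n) l (fun i => (y : EE) i))
    = gegenbauer (lamb n) l ⟪(z : EE), (y : EE)⟫ := by
  have h : eval (fun i => (z : EE) i) (rsq : MvPolynomial (Fin (n + 1)) ℝ) = 1 := by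
    refine Eq.trans ?_ (sum_sq n z)
    simp [rsq]
  rw [geg_eq, zon, map_sum]
  refine Finset.sum_congr rfl fun k _ => ?_
  rw [map_mul (eval _), eval_C, map_mul (eval _), map_pow, map_pow, h, eval_lin, real_inner_comm, mul_pow]
  ring

lemma lamb_pos (hn : 2 ≤ n) : 0 < lamb n := by
  unfold lamb
  have : (2 : ℝ) ≤ n := by exact_mod_cast hn
  linarith

lemma conv_pow (hn : 2 ≤ n) (l p : ℕ) (hp : p ≤ l) (x y : SS) :
    Kc n (l + p) * ∫ z : SS, gegenbauer (lamb n) l ⟪(z : EE), (y : EE)⟫ * ⟪(x : EE), (z : EE)⟫ ^ p ∂μS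
      = if p = l then l.factorial * gegenbauer (lamb n) l ⟪(x : EE), (y : EE)⟫ * (Kc n 0 * sigmaN n) else 0 := by
  have hz := zon_hom (lamb n) l (fun i => (y : EE) i)
  have hh := zon_harm (lamb n) (lamb_pos n hn) (by simp [lamb]; ring) l (fun i => (y : EE) i) (sum_sq n y)
  have h1 := polar n _ _ (hz.mul ((lin_hom (fun i => (x : EE) i)).pow p))
  simp only [map_mul, map_pow, eval_lin, eval_zon, one_mul] at h1
  rw [← h1]
  split_ifs with h
  · subst h
    rw [E_eq gE gE_stein _ _ _ hz hh, eval_zon]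
    have h2 := polar n 1 0 (isHomogeneous_one _ _)
    simp only [map_one, integral_const, smul_eq_mul, mul_one, sphere_total] at h2
    rw [h2]
  · exact E_lt gE gE_stein _ _ _ _ hz hh (by omega)

lemma geg_cont (lam : ℝ) (l : ℕ) : Continuous (gegenbauer lam l) := by
  unfold gegenbauer
  fun_prop

lemma int_cont (f : SS → ℝ) (hf : Continuous f) : Integrable f μS :=
  hf.integrable_of_hasCompactSupport (HasCompactSupport.of_compactSpace f)

lemma conv_le (hn : 2 ≤ n) (l k : ℕ) (hk : k ≤ l) (x y : SS) :
    ∫ z : SS, gegenbauer (lamb n) k ⟪(x : EE), (z : EE)⟫ * gegenbauer (lamb n) l ⟪(z : EE), (y : EE)⟫ ∂μS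
      = if k = l then sigmaN n * (lamb n / (lamb n + l)) * gegenbauer (lamb n) l ⟪(x : EE), (y : EE)⟫ else 0 := by
  have hlam := lamb_pos n hn
  have e : ∀ z : SS, gegenbauer (lamb n) k ⟪(x : EE), (z : EE)⟫ * gegenbauer (lamb n) l ⟪(z : EE), (y : EE)⟫
      = ∑ j ∈ Finset.range (k / 2 + 1), gc (lamb n) k j * 2 ^ (k - 2 * j) *
        (gegenbauer (lamb n) l ⟪(z : EE), (y : EE)⟫ * ⟪(x : EE), (z : EE)⟫ ^ (k - 2 * j)) := by
    intro z
    rw [geg_eq (lamb n) k, Finset.sum_mul]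
    refine Finset.sum_congr rfl fun j _ => ?_
    rw [mul_pow]; ring
  simp only [e]
  rw [integral_finsetSum _ fun j _ => int_cont n _ (by have := geg_cont (lamb n) l; fun_prop)]
  simp only [integral_const_mul]
  have hI : ∀ p, p ≤ l → ∫ z : SS, gegenbauer (lamb n) l ⟪(z : EE), (y : EE)⟫ * ⟪(x : EE), (z : EE)⟫ ^ p ∂μS
      = if p = l then l.factorial * gegenbauer (lamb n) l ⟪(x : EE), (y : EE)⟫ * (Kc n 0 * sigmaN n) / Kc n (2 * l) else 0 := by
    intro p hp
    have h := conv_pow n hn l p hp x y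
    have hK := (Kc_pos n (l + p)).ne'
    split_ifs at h ⊢ with hpl
    · subst hpl
      rw [two_mul, eq_div_iff hK, mul_comm, h]
    · exact (mul_eq_zero.1 h).resolve_left hK
  rw [Finset.sum_congr rfl fun j _ => by rw [hI (k - 2 * j) (by omega)]]
  split_ifs with hkl
  · subst hkl
    rw [Finset.sum_eq_single 0]
    · have hK0 := Kc_eq n 0
      have hK := Kc_eq n k
      simp only [mul_zero, Nat.sub_zero, if_true]
      rw [mul_zero] at hK0
      rw [hK0, hK]
      have hG := (Real.Gamma_pos_of_pos hlam).ne'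
      have hlk : lamb n + k ≠ 0 := by positivity
      have hG2 := (Real.Gamma_pos_of_pos (show 0 < lamb n + k by positivity)).ne'
      have h2 : (2 : ℝ) ^ lamb n ≠ 0 := by positivity
      unfold gc
      simp only [pow_zero, Nat.cast_zero, add_zero, sub_zero, mul_zero, Nat.sub_zero, Nat.factorial_zero, Nat.cast_one]
      rw [show lamb n + 1 + k = lamb n + k + 1 by ring, Real.Gamma_add_one hlam.ne', Real.Gamma_add_one hlk,
        show (k : ℝ) + lamb n = lamb n + k by ring]
      field_simp
    · intro j hj hj0
      have := Finset.mem_range.1 hj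
      rw [if_neg (by omega), mul_zero]
    · simp
  · refine Finset.sum_eq_zero fun j _ => ?_
    rw [if_neg (by omega), mul_zero]

lemma conv (hn : 2 ≤ n) (k l : ℕ) (x y : SS) :
    ∫ z : SS, gegenbauer (lamb n) k ⟪(x : EE), (z : EE)⟫ * gegenbauer (lamb n) l ⟪(z : EE), (y : EE)⟫ ∂μS
      = if k = l then sigmaN n * (lamb n / (lamb n + l)) * gegenbauer (lamb n) l ⟪(x : EE), (y : EE)⟫ else 0 := by
  rcases le_or_gt k l with h | h
  · exact conv_le n hn l k h x y
  · rw [if_neg h.ne']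
    have := conv_le n hn k l h.le y x
    rw [if_neg h.ne] at this
    rw [← this]
    congr 1; ext z
    rw [real_inner_comm (z : EE) (x : EE), real_inner_comm (y : EE) (z : EE)]; ring

lemma sigmaN_pos (hn : 2 ≤ n) : 0 < sigmaN n := by
  have := lamb_pos n hn
  have := Real.Gamma_pos_of_pos (show 0 < lamb n + 1 by positivity)
  unfold sigmaN
  have := Real.pi_pos
  positivity

lemma geg_le (hn : 2 ≤ n) (l : ℕ) (x y : SS) :
    |gegenbauer (lamb n) l ⟪(x : EE), (y : EE)⟫| ≤ gegenbauer (lamb n) l 1 := by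
  have hlam := lamb_pos n hn
  have hs := sigmaN_pos n hn
  have hc := geg_cont (lamb n) l
  have hxx := conv n hn l l x x
  have hyy := conv n hn l l y y
  have hxy := conv n hn l l x y
  have one : ∀ w : SS, ⟪(w : EE), (w : EE)⟫ = 1 := fun w => by rw [inner_eq, sum_sq]
  rw [if_pos rfl, one] at hxx hyy
  rw [if_pos rfl] at hxy
  set c := sigmaN n * (lamb n / (lamb n + l)) with hcdef
  have hcpos : 0 < c := by positivity
  have h1 : |c * gegenbauer (lamb n) l ⟪(x : EE), (y : EE)⟫| ≤ c * gegenbauer (lamb n) l 1 := by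
    rw [← hxy]
    refine (abs_integral_le_integral_abs).trans ?_
    have : c * gegenbauer (lamb n) l 1 = ∫ z : SS, (1 / 2) * (gegenbauer (lamb n) l ⟪(x : EE), (z : EE)⟫ * gegenbauer (lamb n) l ⟪(z : EE), (x : EE)⟫)
       + (1 / 2) * (gegenbauer (lamb n) l ⟪(y : EE), (z : EE)⟫ * gegenbauer (lamb n) l ⟪(z : EE), (y : EE)⟫) ∂μS := by
      rw [integral_add (int_cont n _ (by fun_prop)) (int_cont n _ (by fun_prop)), integral_const_mul, integral_const_mul, hxx, hyy]
      ring
    rw [this]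
    refine integral_mono (int_cont n _ (by fun_prop)) (int_cont n _ (by fun_prop)) fun z => ?_
    simp only
    rw [real_inner_comm (z : EE) (x : EE), real_inner_comm (z : EE) (y : EE), abs_mul]
    nlinarith [sq_nonneg (|gegenbauer (lamb n) l ⟪(z : EE), (x : EE)⟫| - |gegenbauer (lamb n) l ⟪(z : EE), (y : EE)⟫|),
      sq_abs (gegenbauer (lamb n) l ⟪(z : EE), (x : EE)⟫), sq_abs (gegenbauer (lamb n) l ⟪(z : EE), (y : EE)⟫)]
  rw [abs_mul, abs_of_pos hcpos] at h1
  exact le_of_mul_le_mul_left h1 hcpos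

noncomputable def cf (n k : ℕ) (c : ℝ) (l : ℕ) : ℝ := ((lamb n + l) / lamb n) * psiK k (c * l)

lemma cf_nonneg (hn : 2 ≤ n) (k : ℕ) (c : ℝ) (hc : 0 < c) (l : ℕ) : 0 ≤ cf n k c l := by
  have := lamb_pos n hn
  unfold cf psiK
  positivity

lemma cf_summable (hn : 2 ≤ n) (k : ℕ) (c : ℝ) (hc : 0 < c) :
    Summable fun l => cf n k c l * gegenbauer (lamb n) l 1 := by
  have hlam := lamb_pos n hn
  have hb := geg_bound n (lamb n) hlam (by unfold lamb; linarith)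
  have hs := (summable_nat_add_iff 1).2 (Real.summable_pow_mul_exp_neg_nat_mul (1 + k + n) hc)
  refine Summable.of_nonneg_of_le (fun l => mul_nonneg (cf_nonneg n hn k c hc l) (hb l).1) (fun l => ?_)
    (hs.mul_left ((1 + 1 / lamb n) * (2 ^ k / Real.sqrt (Real.Gamma (2 * k)) * c ^ k) * Real.exp c))
  have hl : (0 : ℝ) ≤ l := by positivity
  have h1 : (lamb n + l) / lamb n ≤ (1 + 1 / lamb n) * (l + 1) := by
    rw [div_le_iff₀ hlam]
    field_simp
    nlinarith
  have h2 : psiK k (c * l) ≤ (2 ^ k / Real.sqrt (Real.Gamma (2 * k)) * c ^ k) * (l + 1) ^ k * Real.exp (-(c * l)) := by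
    unfold psiK
    rw [mul_pow, ← mul_assoc]
    gcongr
    linarith
  have h3 : Real.exp (-(c * l)) = Real.exp c * Real.exp (-c * ((l + 1 : ℕ) : ℝ)) := by
    rw [← Real.exp_add]; congr 1; push_cast; ring
  have h0 : 0 ≤ psiK k (c * l) := by unfold psiK; positivity
  calc cf n k c l * gegenbauer (lamb n) l 1
      ≤ ((1 + 1 / lamb n) * (l + 1)) * ((2 ^ k / Real.sqrt (Real.Gamma (2 * k)) * c ^ k) * (l + 1) ^ k * Real.exp (-(c * l)))
        * (l + 1 : ℝ) ^ n := by
        unfold cf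
        have := (hb l).1
        have := (hb l).2
        gcongr
    _ = _ := by
        rw [h3]; push_cast; ring

lemma cf_mul (hn : 2 ≤ n) (m : ℕ) (hm : 1 ≤ m) (a b : ℝ) (ha : 0 < a) (hb : 0 < b) (l : ℕ) :
    cf n m a l * cf n m b l * (lamb n / (lamb n + l)) =
      Real.sqrt (Real.Gamma (4 * m)) / Real.Gamma (2 * m) *
          ((a * b) ^ m / (a + b) ^ (2 * m)) * cf n (2 * m) (a + b) l := by
  have hlam := lamb_pos n hn
  have hm' : (0 : ℝ) < m := by exact_mod_cast hm
  have hG := Real.Gamma_pos_of_pos (show (0 : ℝ) < 2 * m by positivity)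
  have hG4 := Real.Gamma_pos_of_pos (show (0 : ℝ) < 4 * m by positivity)
  have hsq := Real.mul_self_sqrt hG.le
  have hs := (Real.sqrt_pos.2 hG)
  have hs4 := (Real.sqrt_pos.2 hG4)
  have hll : lamb n + l ≠ 0 := by positivity
  unfold cf psiK
  rw [show (2 * ((2 * m : ℕ) : ℝ)) = 4 * m by push_cast; ring, show -((a + b) * l) = -(a * l) + -(b * l) by ring,
    Real.exp_add]
  nth_rewrite 3 [← hsq]
  have hab : a + b ≠ 0 := by positivity
  simp only [mul_pow, pow_mul']
  field_simp

set_option maxHeartbeats 2000000 in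
theorem final (hn : 2 ≤ n) (m : ℕ) (hm : 1 ≤ m) (a b : ℝ) (ha : 0 < a) (hb : 0 < b) (x y : SS) :
    (1 / sigmaN n) * ∫ z : SS, Gw n m a ⟪(x : EE), (z : EE)⟫ * Gw n m b ⟪(z : EE), (y : EE)⟫ ∂μS
      = Real.sqrt (Real.Gamma (4 * m)) / Real.Gamma (2 * m) *
          ((a * b) ^ m / (a + b) ^ (2 * m)) * Gw n (2 * m) (a + b) ⟪(x : EE), (y : EE)⟫ := by
  have hs := sigmaN_pos n hn
  have hlam := lamb_pos n hn
  have hA := cf_summable n hn m a ha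
  have hB := cf_summable n hn m b hb
  have hc := geg_cont (lamb n)
  set u : ℕ → ℝ := fun l => gegenbauer (lamb n) l 1 with hu
  have hGw : ∀ k c t, Gw n k c t = ∑' l, cf n k c l * gegenbauer (lamb n) l t := fun _ _ _ => rfl
  have bd : ∀ c, 0 < c → ∀ l (v w : SS), ‖cf n m c l * gegenbauer (lamb n) l ⟪(v : EE), (w : EE)⟫‖ ≤ cf n m c l * u l := by
    intro c hc l v w
    rw [Real.norm_eq_abs, abs_mul, abs_of_nonneg (cf_nonneg n hn m c hc l)]
    exact mul_le_mul_of_nonneg_left (geg_le n hn l v w) (cf_nonneg n hn m c hc l)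
  set F : ℕ × ℕ → SS → ℝ := fun p z => (cf n m a p.1 * gegenbauer (lamb n) p.1 ⟪(x : EE), (z : EE)⟫) *
    (cf n m b p.2 * gegenbauer (lamb n) p.2 ⟪(z : EE), (y : EE)⟫) with hF
  have hFc : ∀ p, Continuous (F p) := by
    intro p
    have := hc p.1
    have := hc p.2
    simp only [hF]
    fun_prop
  have hFb : ∀ p z, ‖F p z‖ ≤ (cf n m a p.1 * u p.1) * (cf n m b p.2 * u p.2) := by
    intro p z
    simp only [hF, norm_mul (cf n m a p.1 * _)]
    exact mul_le_mul (bd a ha _ _ _) (bd b hb _ _ _) (norm_nonneg _) ((norm_nonneg _).trans (bd a ha p.1 x z))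
  have hprod : ∀ z : SS, Gw n m a ⟪(x : EE), (z : EE)⟫ * Gw n m b ⟪(z : EE), (y : EE)⟫ = ∑' p, F p z := by
    intro z
    rw [hGw, hGw]
    exact tsum_mul_tsum_of_summable_norm
      (Summable.of_nonneg_of_le (fun _ => norm_nonneg _) (fun l => bd a ha l x z) hA)
      (Summable.of_nonneg_of_le (fun _ => norm_nonneg _) (fun l => bd b hb l z y) hB)
  have hAB : Summable fun p : ℕ × ℕ => (cf n m a p.1 * u p.1) * (cf n m b p.2 * u p.2) :=
    hA.mul_of_nonneg hB (fun l => (norm_nonneg _).trans (bd a ha l x x)) (fun l => (norm_nonneg _).trans (bd b hb l x x))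
  have hsum : Summable fun p => ∫ z, ‖F p z‖ ∂μS := by
    refine Summable.of_nonneg_of_le (fun p => integral_nonneg fun _ => norm_nonneg _) (fun p => ?_) (hAB.mul_left (sigmaN n))
    calc _ ≤ ∫ z : SS, (cf n m a p.1 * u p.1) * (cf n m b p.2 * u p.2) ∂μS :=
          integral_mono (int_cont n _ (hFc p).norm) (integrable_const _) (hFb p)
      _ = _ := by rw [integral_const, smul_eq_mul, sphere_total]
  have hH := hasSum_integral_of_summable_integral_norm (μ := μS) (fun p => int_cont n _ (hFc p)) hsum
  have hFi : ∀ p : ℕ × ℕ, ∫ z, F p z ∂μS = if p.1 = p.2 then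
      sigmaN n * (cf n m a p.2 * cf n m b p.2 * (lamb n / (lamb n + p.2)) * gegenbauer (lamb n) p.2 ⟪(x : EE), (y : EE)⟫) else 0 := by
    intro p
    have : ∀ z, F p z = (cf n m a p.1 * cf n m b p.2) * (gegenbauer (lamb n) p.1 ⟪(x : EE), (z : EE)⟫ *
      gegenbauer (lamb n) p.2 ⟪(z : EE), (y : EE)⟫) := fun z => by simp only [hF]; ring
    simp only [this]
    rw [integral_const_mul, conv n hn]
    split_ifs with h
    · rw [h]; ring
    · simp
  simp only [hprod]
  rw [← hH.tsum_eq, hH.summable.tsum_prod, hGw, ← tsum_mul_left, ← tsum_mul_left]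
  refine tsum_congr fun l => ?_
  rw [tsum_eq_single l, hFi, if_pos rfl, ← mul_assoc]
  · simp only
    rw [cf_mul n hn m hm a b ha hb, one_div, inv_mul_cancel₀ hs.ne', one_mul]
    ring
  · intro k hk
    rw [hFi, if_neg (fun h => hk h.symm)]
end Conv
end GW

/-- the reproducing-kernel identity
`(1/Σ_n) ∫_{S^n} G_a^m(⟨x,z⟩) G_b^m(⟨z,y⟩) dσ(z)
  = (√Γ(4m)/Γ(2m)) (ab)^m (a+b)^{-2m} G_{a+b}^{2m}(⟨x,y⟩)`. -/
theorem stmt18 (n m : ℕ) (hn : 2 ≤ n) (hm : 1 ≤ m) (a b : ℝ) (ha : 0 < a) (hb : 0 < b)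
    (x y : Metric.sphere (0 : EuclideanSpace ℝ (Fin (n + 1))) 1) :
    (1 / sigmaN n) *
        ∫ z : Metric.sphere (0 : EuclideanSpace ℝ (Fin (n + 1))) 1,
          Gw n m a ⟪(x : EuclideanSpace ℝ (Fin (n + 1))), (z : EuclideanSpace ℝ (Fin (n + 1)))⟫ *
            Gw n m b ⟪(z : EuclideanSpace ℝ (Fin (n + 1))), (y : EuclideanSpace ℝ (Fin (n + 1)))⟫
          ∂((volume : Measure (EuclideanSpace ℝ (Fin (n + 1)))).toSphere)
      = Real.sqrt (Real.Gamma (4 * m)) / Real.Gamma (2 * m) *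
          ((a * b) ^ m / (a + b) ^ (2 * m)) *
          Gw n (2 * m) (a + b)
            ⟪(x : EuclideanSpace ℝ (Fin (n + 1))), (y : EuclideanSpace ℝ (Fin (n + 1)))⟫ := by
  exact GW.final n hn m hm a b ha hb x y
end
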